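/- Let 𝒬̃ ⊆ ℂ[x₁,…,xₙ] be a finite set of pairwise linearly independent homogeneous quadratics, each either irreducible or the square of a linear form, such that for every two distinct Q, Q' ∈ 𝒬̃ the product of all elements of 𝒬̃ ∖ {Q,Q'} lies in √⟨Q,Q'⟩. Suppose there is a space V of linear forms with dim V = Δ ≥ 1 such that every Q ∈ 𝒬̃ satisfies: Q ∈ ⟨V⟩ (the ideal generated by V), or there is a linear form a (depending on Q) with MS(Q) ⊆ V + span_ℂ{a}. Then dim span_ℂ 𝒬̃ ≤ 20·Δ² (the paper states the bound 8Δ²). -/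

import Mathlib

open MvPolynomial

/-- `rankS Q` is the minimal `r` such that `Q = ∑_{i=1}^r a_i · b_i` for linear forms
`a_i, b_i`. -/
noncomputable def rankS {σ : Type*} (Q : MvPolynomial σ ℂ) : ℕ :=
  sInf {r : ℕ | ∃ a b : Fin r → MvPolynomial σ ℂ,
    (∀ i, (a i).IsHomogeneous 1) ∧ (∀ i, (b i).IsHomogeneous 1) ∧ Q = ∑ i, a i * b i}

/-- `MS Q` is the minimal space of `Q`: the span of the linear forms appearing in a
minimal representation of `Q`. -/
noncomputable def MS {σ : Type*} (Q : MvPolynomial σ ℂ) : Submodule ℂ (MvPolynomial σ ℂ) :=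
  sInf {V : Submodule ℂ (MvPolynomial σ ℂ) | ∃ a b : Fin (rankS Q) → MvPolynomial σ ℂ,
    (∀ i, (a i).IsHomogeneous 1) ∧ (∀ i, (b i).IsHomogeneous 1) ∧ Q = ∑ i, a i * b i ∧
    V = Submodule.span ℂ (Set.range a ∪ Set.range b)}

/-- Three linearly dependent unit vectors cannot be too close to pairwise orthogonal. -/
theorem three_quarters_le_of_not_linearIndependent {E : Type*} [NormedAddCommGroup E]
    [InnerProductSpace ℂ E] {a b c : E} (ha : ‖a‖ = 1) (hb : ‖b‖ = 1) (hc : ‖c‖ = 1)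
    (h : ¬ LinearIndependent ℂ ![a, b, c]) :
    3 / 4 ≤ ‖inner ℂ a b‖ ^ 2 + ‖inner ℂ b c‖ ^ 2 + ‖inner ℂ a c‖ ^ 2 := by
  have hdet : (Matrix.gram ℂ ![a, b, c]).det = 0 := by
    obtain ⟨g, hg, i, hi⟩ := Fintype.not_linearIndependent_iff.mp h
    refine Matrix.exists_mulVec_eq_zero_iff.mp ⟨g, fun h0 => hi (congrFun h0 i), ?_⟩
    ext k
    have := congrArg (fun z => inner ℂ (![a, b, c] k) z) hg
    simp only [inner_sum, inner_smul_right, inner_zero_right] at this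
    simpa [Matrix.mulVec, dotProduct, Matrix.gram_apply, mul_comm] using this
  rw [Matrix.det_fin_three] at hdet
  simp only [Matrix.gram_apply, Matrix.cons_val_zero, Matrix.cons_val_one,
    Matrix.cons_val, inner_self_eq_norm_sq_to_K, ha, hb, hc] at hdet
  rw [← inner_conj_symm b a, ← inner_conj_symm c b, ← inner_conj_symm c a] at hdet
  generalize inner ℂ a b = x at *
  generalize inner ℂ b c = y at *
  generalize inner ℂ a c = z at *
  have hsum : ‖x‖ ^ 2 + ‖y‖ ^ 2 + ‖z‖ ^ 2 = 1 + 2 * (x * y * (starRingEnd ℂ) z).re := by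
    have hre := congrArg Complex.re hdet
    simp only [← Complex.normSq_eq_norm_sq, Complex.normSq_apply]
    simp at hre ⊢
    linear_combination -hre
  have hre : -(‖x‖ * ‖y‖ * ‖z‖) ≤ (x * y * (starRingEnd ℂ) z).re := by
    have := (abs_le.mp (Complex.abs_re_le_norm (x * y * (starRingEnd ℂ) z))).1
    simpa using this
  have hx := norm_nonneg x
  have hy := norm_nonneg y
  have hz := norm_nonneg z
  generalize ‖x‖ = p at *
  generalize ‖y‖ = q at *
  generalize ‖z‖ = r at *
  by_contra! hlt
  have hamgm : p ^ 2 * q ^ 2 * r ^ 2 ≤ ((p ^ 2 + q ^ 2 + r ^ 2) / 3) ^ 3 := by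
    have hp2 := sq_nonneg p
    have hq2 := sq_nonneg q
    have hr2 := sq_nonneg r
    generalize p ^ 2 = P at *
    generalize q ^ 2 = S at *
    generalize r ^ 2 = T at *
    nlinarith [mul_nonneg hp2 (sq_nonneg (S - T)), mul_nonneg hq2 (sq_nonneg (P - T)),
      mul_nonneg hr2 (sq_nonneg (S - P)), mul_nonneg (add_nonneg (add_nonneg hp2 hq2) hr2)
      (add_nonneg (add_nonneg (sq_nonneg (P - S)) (sq_nonneg (S - T))) (sq_nonneg (P - T)))]
  have hcube : ((p ^ 2 + q ^ 2 + r ^ 2) / 3) ^ 3 ≤ (1 / 4) ^ 3 :=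
    pow_le_pow_left₀ (by positivity) (by linarith) 3
  have hpqr : p * q * r ≤ 1 / 8 := by
    refine le_of_sq_le_sq ?_ (by norm_num)
    nlinarith
  linarith

/-- A finite family of vectors representing pairwise distinct points of a projective space such
that every line through two of the points contains a third one. -/
structure IsSylvesterGallai {ι U : Type*} [AddCommGroup U] [Module ℂ U]
    (v : ι → U) : Prop where
  pair : ∀ i j, i ≠ j → LinearIndependent ℂ ![v i, v j]
  third : ∀ i j, i ≠ j → ∃ k, k ≠ i ∧ k ≠ j ∧ v k ∈ Submodule.span ℂ {v i, v j}

namespace IsSylvesterGallai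

variable {ι U : Type*} [AddCommGroup U] [Module ℂ U] {v : ι → U}

theorem finrank_span_pair {x y : U} (h : LinearIndependent ℂ ![x, y]) :
    Module.finrank ℂ (Submodule.span ℂ {x, y}) = 2 := by
  have := finrank_span_eq_card h
  rwa [Matrix.range_cons_cons_empty, Fintype.card_fin] at this

theorem span_pair_eq {x y z : U} (hxy : LinearIndependent ℂ ![x, y])
    (hxz : LinearIndependent ℂ ![x, z]) (hz : z ∈ Submodule.span ℂ {x, y}) :
    Submodule.span ℂ {x, z} = Submodule.span ℂ {x, y} := by
  have : FiniteDimensional ℂ (Submodule.span ℂ {x, y}) :=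
    FiniteDimensional.span_of_finite ℂ (Set.toFinite _)
  refine Submodule.eq_of_le_of_finrank_eq ?_ ?_
  · rw [Submodule.span_le]
    rintro w (rfl | rfl)
    · exact Submodule.subset_span (by simp)
    · exact hz
  · rw [finrank_span_pair hxy, finrank_span_pair hxz]

theorem line_eq (h : IsSylvesterGallai v) {i j k : ι} (hij : i ≠ j) (hki : k ≠ i)
    (hk : v k ∈ Submodule.span ℂ {v i, v j}) :
    Submodule.span ℂ {v i, v k} = Submodule.span ℂ {v i, v j} :=
  span_pair_eq (h.pair i j hij) (h.pair i k hki.symm) hk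

theorem line_eq_of_ne (h : IsSylvesterGallai v) {i j k : ι} (hij : i ≠ j) (hkj : k ≠ j)
    (hk : v k ∈ Submodule.span ℂ {v i, v j}) :
    Submodule.span ℂ {v j, v k} = Submodule.span ℂ {v i, v j} := by
  rw [Set.pair_comm (v i)] at hk ⊢
  exact h.line_eq hij.symm hkj hk

open Classical in
/-- The unit vectors of a Sylvester–Gallai family have large average correlation. -/
theorem le_sum_norm_inner_sq [Fintype ι] {E : Type*} [NormedAddCommGroup E]
    [InnerProductSpace ℂ E] {u : ι → E} (h : IsSylvesterGallai u) (hu : ∀ i, ‖u i‖ = 1) :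
    (Fintype.card ι : ℝ) + Fintype.card ι * (Fintype.card ι - 1) / 4 ≤
      ∑ i, ∑ j, ‖inner ℂ (u i) (u j)‖ ^ 2 := by
  set c : ι → ι → ℝ := fun i j => ‖inner ℂ (u i) (u j)‖ ^ 2 with hc
  let T : ι → ι → ι → Prop := fun i j k =>
    i ≠ j ∧ k ≠ i ∧ k ≠ j ∧ u k ∈ Submodule.span ℂ {u i, u j}
  let D : ι → ι → ℝ := fun i j =>
    (Finset.univ.filter fun k => u k ∈ Submodule.span ℂ {u i, u j}).card - 2
  have hT1 : ∀ i j k, T i j k → T j k i := by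
    rintro i j k ⟨hij, hki, hkj, hk⟩
    refine ⟨hkj.symm, hij, hki.symm, ?_⟩
    rw [h.line_eq_of_ne hij hkj hk]
    exact Submodule.subset_span (by simp)
  have hT2 : ∀ i j k, T i j k → T i k j := by
    rintro i j k ⟨hij, hki, hkj, hk⟩
    refine ⟨hki.symm, hij.symm, hkj.symm, ?_⟩
    rw [h.line_eq hij hki hk]
    exact Submodule.subset_span (by simp)
  have hD1 : ∀ i j k, T i j k → D j k = D i j := by
    rintro i j k ⟨hij, hki, hkj, hk⟩
    simp only [D, h.line_eq_of_ne hij hkj hk]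
  have hD2 : ∀ i j k, T i j k → D i k = D i j := by
    rintro i j k ⟨hij, hki, hkj, hk⟩
    simp only [D, h.line_eq hij hki hk]
  have hcard : ∀ i j, i ≠ j → ((Finset.univ.filter fun k => T i j k).card : ℝ) = D i j := by
    intro i j hij
    have hset : (Finset.univ.filter fun k => u k ∈ Submodule.span ℂ {u i, u j}) =
        insert i (insert j (Finset.univ.filter fun k => T i j k)) := by
      ext k
      simp only [Finset.mem_filter, Finset.mem_univ, true_and, Finset.mem_insert, T]
      constructor
      · intro hk
        by_cases hki : k = i
        · exact Or.inl hki
        · by_cases hkj : k = j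
          · exact Or.inr (Or.inl hkj)
          · exact Or.inr (Or.inr ⟨hij, hki, hkj, hk⟩)
      · rintro (rfl | rfl | hk)
        · exact Submodule.subset_span (by simp)
        · exact Submodule.subset_span (by simp)
        · exact hk.2.2.2
    simp only [D]
    rw [hset, Finset.card_insert_of_notMem (by simp [hij, T]),
      Finset.card_insert_of_notMem (by simp [T])]
    push_cast
    ring
  have hDpos : ∀ i j, i ≠ j → 0 < D i j := by
    intro i j hij
    rw [← hcard i j hij]
    obtain ⟨k, hki, hkj, hk⟩ := h.third i j hij
    have hmem : k ∈ Finset.univ.filter fun k => T i j k :=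
      Finset.mem_filter.mpr ⟨Finset.mem_univ _, hij, hki, hkj, hk⟩
    exact_mod_cast Finset.card_pos.mpr ⟨k, hmem⟩
  have hcollapse : ∀ g : ι → ι → ℝ, ∑ i, ∑ j, ∑ k, (if T i j k then g i j / D i j else 0) =
      ∑ i, ∑ j, if i = j then 0 else g i j := by
    intro g
    refine Finset.sum_congr rfl fun i _ => Finset.sum_congr rfl fun j _ => ?_
    split_ifs with hij
    · exact Finset.sum_eq_zero fun k _ => if_neg fun hT => hT.1 hij
    · rw [← Finset.sum_filter, Finset.sum_const, nsmul_eq_mul, hcard i j hij]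
      have := (hDpos i j hij).ne'
      field_simp
  let F : ι → ι → ι → ℝ := fun i j k => if T i j k then c i j / D i j else 0
  have hpt : ∀ i j k, (if T i j k then (3 / 4) / D i j else 0) ≤ F i j k + F j k i + F i k j := by
    intro i j k
    by_cases hT : T i j k
    · simp only [F, if_pos hT, if_pos (hT1 i j k hT), if_pos (hT2 i j k hT), hD1 i j k hT,
        hD2 i j k hT, ← add_div]
      refine div_le_div_of_nonneg_right ?_ (hDpos i j hT.1).le
      refine three_quarters_le_of_not_linearIndependent (hu i) (hu j) (hu k) fun hli => ?_
      have hnot := (linearIndependent_finSnoc (K := ℂ) (v := ![u i, u j]) (x := u k)).mp (by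
        have heq : (Fin.snoc ![u i, u j] (u k) : Fin 3 → E) = ![u i, u j, u k] := by
          ext l
          fin_cases l <;> rfl
        rwa [heq])
      rw [Matrix.range_cons_cons_empty] at hnot
      exact hnot.2 hT.2.2.2
    · have h1 : ¬ T j k i := fun h' => hT (hT1 _ _ _ (hT1 _ _ _ h'))
      have h2 : ¬ T i k j := fun h' => hT (hT2 _ _ _ h')
      simp [F, hT, h1, h2]
  have hsum : ∑ i, ∑ j, ∑ k, (if T i j k then (3 / 4) / D i j else 0) ≤
      ∑ i, ∑ j, ∑ k, (F i j k + F j k i + F i k j) :=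
    Finset.sum_le_sum fun i _ => Finset.sum_le_sum fun j _ => Finset.sum_le_sum fun k _ =>
      hpt i j k
  have hrot : ∑ i, ∑ j, ∑ k, F j k i = ∑ i, ∑ j, ∑ k, F i j k := by
    rw [Finset.sum_comm]
    exact Finset.sum_congr rfl fun i _ => Finset.sum_comm
  have hswap : ∑ i, ∑ j, ∑ k, F i k j = ∑ i, ∑ j, ∑ k, F i j k :=
    Finset.sum_congr rfl fun i _ => Finset.sum_comm
  simp only [Finset.sum_add_distrib] at hsum
  rw [hrot, hswap, hcollapse (fun _ _ => 3 / 4)] at hsum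
  have hF : ∑ i, ∑ j, ∑ k, F i j k = ∑ i, ∑ j, if i = j then 0 else c i j := hcollapse c
  rw [hF] at hsum
  have hdiag : ∑ i, ∑ j, c i j = Fintype.card ι + ∑ i, ∑ j, if i = j then 0 else c i j := by
    have : (Fintype.card ι : ℝ) = ∑ i : ι, (1 : ℝ) := by simp
    rw [this, ← Finset.sum_add_distrib]
    refine Finset.sum_congr rfl fun i _ => ?_
    have hci : c i i = 1 := by simp [hc, hu i]
    rw [← Finset.add_sum_erase _ _ (Finset.mem_univ i), hci,
      ← Finset.add_sum_erase _ _ (Finset.mem_univ i), if_pos rfl, zero_add]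
    congr 1
    exact Finset.sum_congr rfl fun j hj => (if_neg (Finset.ne_of_mem_erase hj).symm).symm
  have hconst : ∑ i : ι, ∑ j : ι, (if i = j then (0 : ℝ) else 3 / 4) =
      3 / 4 * (Fintype.card ι * (Fintype.card ι - 1)) := by
    have : ∀ i : ι, ∑ j : ι, (if i = j then (0 : ℝ) else 3 / 4) =
        3 / 4 * (Fintype.card ι - 1) := by
      intro i
      have h1 : ∀ j, (if i = j then (0 : ℝ) else 3 / 4) = 3 / 4 - if i = j then 3 / 4 else 0 := by
        intro j
        split_ifs <;> ring
      simp only [h1, Finset.sum_sub_distrib, Finset.sum_ite_eq, Finset.mem_univ, if_true]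
      simp
      ring
    simp only [this, Finset.sum_const, Finset.card_univ, nsmul_eq_mul]
    ring
  rw [hconst] at hsum
  rw [hdiag]
  linarith

open Classical in
/-- A hyperplane contains less than half of the points of a spanning Sylvester–Gallai family. -/
theorem two_mul_card_lt [Fintype ι] (h : IsSylvesterGallai v) {H : Submodule ℂ U}
    (hH : ∃ p, v p ∉ H) :
    2 * (Finset.univ.filter fun i => v i ∈ H).card < Fintype.card ι := by
  obtain ⟨p, hp⟩ := hH
  have hthird : ∀ q, v q ∈ H → ∃ r, r ≠ p ∧ r ≠ q ∧ v r ∈ Submodule.span ℂ {v p, v q} :=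
    fun q hq => h.third p q (by rintro rfl; exact hp hq)
  choose! σ hσ using hthird
  have hne : ∀ q, v q ∈ H → p ≠ q := by
    rintro q hq rfl
    exact hp hq
  have hout : ∀ q, v q ∈ H → v (σ q) ∉ H := by
    intro q hq hr
    obtain ⟨hrp, hrq, hmem⟩ := hσ q hq
    have hspan := h.line_eq_of_ne (hne q hq) hrq hmem
    have hpm : v p ∈ Submodule.span ℂ {v q, v (σ q)} := by
      rw [hspan]
      exact Submodule.subset_span (by simp)
    refine hp ((Submodule.span_le.mpr ?_ : Submodule.span ℂ {v q, v (σ q)} ≤ H) hpm)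
    rintro w (rfl | rfl)
    exacts [hq, hr]
  have hinj : Set.InjOn σ (Finset.univ.filter fun i => v i ∈ H) := by
    intro q hq q' hq' heq
    simp only [Finset.coe_filter, Finset.mem_univ, true_and, Set.mem_ofPred_eq] at hq hq'
    by_contra hqq
    have h1 := h.line_eq (hne q hq) (hσ q hq).1 (hσ q hq).2.2
    have h2 := h.line_eq (hne q' hq') (hσ q' hq').1 (hσ q' hq').2.2
    rw [← heq, h1] at h2
    have hq'mem : v q' ∈ Submodule.span ℂ {v p, v q} := by
      rw [h2]
      exact Submodule.subset_span (by simp)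
    have h3 := h.line_eq_of_ne (hne q hq) (Ne.symm hqq) hq'mem
    have hpm : v p ∈ Submodule.span ℂ {v q, v q'} := by
      rw [h3]
      exact Submodule.subset_span (by simp)
    refine hp ((Submodule.span_le.mpr ?_ : Submodule.span ℂ {v q, v q'} ≤ H) hpm)
    rintro w (rfl | rfl)
    exacts [hq, hq']
  set A := Finset.univ.filter fun i => v i ∈ H with hA
  have hmemA : ∀ {q}, q ∈ A ↔ v q ∈ H := by simp [hA]
  have hdisj : Disjoint A (insert p (A.image σ)) := by
    rw [Finset.disjoint_left]
    intro q hq hq'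
    rcases Finset.mem_insert.mp hq' with rfl | hq'
    · exact hp (hmemA.mp hq)
    · obtain ⟨r, hr, rfl⟩ := Finset.mem_image.mp hq'
      exact hout r (hmemA.mp hr) (hmemA.mp hq)
  have hpnot : p ∉ A.image σ := by
    intro hmem
    obtain ⟨r, hr, hrp⟩ := Finset.mem_image.mp hmem
    exact (hσ r (hmemA.mp hr)).1 hrp
  have hle := Finset.card_le_univ (A ∪ insert p (A.image σ))
  rw [Finset.card_union_of_disjoint hdisj, Finset.card_insert_of_notMem hpnot,
    Finset.card_image_of_injOn hinj] at hle
  omega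

end IsSylvesterGallai

namespace IsSylvesterGallai

variable {ι U : Type*} [Fintype ι] [AddCommGroup U] [Module ℂ U] {v : ι → U}

theorem exists_min_notMem (l : ι → ℝ) {H : Submodule ℂ U} (hH : ∃ p, v p ∉ H) :
    ∃ q, v q ∉ H ∧ ∀ p, v p ∉ H → l q ≤ l p := by
  classical
  obtain ⟨p, hp⟩ := hH
  obtain ⟨q, hq, hmin⟩ := Finset.exists_min_image (Finset.univ.filter fun i => v i ∉ H) l
    ⟨p, by simpa using hp⟩
  exact ⟨q, by simpa using hq, fun r hr => hmin r (by simpa using hr)⟩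

/-- The greedy basis for a weight `l` on a Sylvester–Gallai family spanning a space of
dimension four: its weight is small compared to the total weight. -/
theorem exists_greedy_basis (h : IsSylvesterGallai v) (hspan : Submodule.span ℂ (Set.range v) = ⊤)
    (hdim : Module.finrank ℂ U = 4) (l : ι → ℝ) :
    ∃ b : Fin 4 → ι, LinearIndependent ℂ (v ∘ b) ∧ (∀ i, l (b 0) ≤ l i) ∧
      (∀ k, l (b k) ≤ l (b 3)) ∧
      Fintype.card ι * ∑ k, l (b k) + (l (b 3) - l (b 0)) ≤ 4 * ∑ i, l i := by
  classical
  have hproper : ∀ {k : ℕ} (t : Fin k → U), k < 4 → ∃ p, v p ∉ Submodule.span ℂ (Set.range t) := by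
    intro k t hk
    by_contra! hall
    have htop : Submodule.span ℂ (Set.range t) = ⊤ := by
      rw [eq_top_iff, ← hspan, Submodule.span_le]
      rintro _ ⟨p, rfl⟩
      exact hall p
    have := finrank_range_le_card (R := ℂ) t
    rw [Set.finrank, htop, finrank_top, hdim, Fintype.card_fin] at this
    omega
  obtain ⟨a, ha, hamin⟩ := exists_min_notMem l (hproper (![] : Fin 0 → U) (by norm_num))
  obtain ⟨b, hb, hbmin⟩ := exists_min_notMem l (hproper ![v a] (by norm_num))
  obtain ⟨c, hc, hcmin⟩ := exists_min_notMem l (hproper ![v a, v b] (by norm_num))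
  obtain ⟨d, hd, hdmin⟩ := exists_min_notMem l (hproper ![v a, v b, v c] (by norm_num))
  have snoc1 : (Fin.snoc ![] (v a) : Fin 1 → U) = ![v a] := by
    ext l; fin_cases l; rfl
  have snoc2 : (Fin.snoc ![v a] (v b) : Fin 2 → U) = ![v a, v b] := by
    ext l; fin_cases l <;> rfl
  have snoc3 : (Fin.snoc ![v a, v b] (v c) : Fin 3 → U) = ![v a, v b, v c] := by
    ext l; fin_cases l <;> rfl
  have snoc4 : (Fin.snoc ![v a, v b, v c] (v d) : Fin 4 → U) = v ∘ ![a, b, c, d] := by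
    ext l; fin_cases l <;> rfl
  have li1 : LinearIndependent ℂ ![v a] := by
    rw [← snoc1]
    exact linearIndependent_finSnoc.mpr ⟨linearIndependent_empty_type, ha⟩
  have li2 : LinearIndependent ℂ ![v a, v b] := by
    rw [← snoc2]
    exact linearIndependent_finSnoc.mpr ⟨li1, hb⟩
  have li3 : LinearIndependent ℂ ![v a, v b, v c] := by
    rw [← snoc3]
    exact linearIndependent_finSnoc.mpr ⟨li2, hc⟩
  have li4 : LinearIndependent ℂ (v ∘ ![a, b, c, d]) := by
    rw [← snoc4]
    exact linearIndependent_finSnoc.mpr ⟨li3, hd⟩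
  set H0 := Submodule.span ℂ (Set.range (![] : Fin 0 → U)) with hH0
  set H1 := Submodule.span ℂ (Set.range ![v a]) with hH1
  set H2 := Submodule.span ℂ (Set.range ![v a, v b]) with hH2
  set H3 := Submodule.span ℂ (Set.range ![v a, v b, v c]) with hH3
  have le01 : H0 ≤ H1 := by simp [hH0]
  have le12 : H1 ≤ H2 := by
    refine Submodule.span_mono ?_
    rintro _ ⟨i, rfl⟩
    exact ⟨i.castSucc, by fin_cases i; rfl⟩
  have le23 : H2 ≤ H3 := by
    refine Submodule.span_mono ?_
    rintro _ ⟨i, rfl⟩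
    exact ⟨i.castSucc, by fin_cases i <;> rfl⟩
  have hab : l a ≤ l b := hamin b fun hx => hb (le01 hx)
  have hbc : l b ≤ l c := hbmin c fun hx => hc (le12 hx)
  have hcd : l c ≤ l d := hcmin d fun hx => hd (le23 hx)
  have hne : ∀ i, v i ≠ 0 := by
    intro i h0
    obtain ⟨j, hj⟩ : ∃ j, j ≠ i := by
      by_contra! hall
      exact hb (by rw [hall b, ← hall a]; exact Submodule.subset_span ⟨0, rfl⟩)
    exact (h.pair i j hj.symm).ne_zero 0 h0
  have hmina : ∀ i, l a ≤ l i := fun i => hamin i (by simpa [hH0] using hne i)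
  set n := Fintype.card ι with hn
  set N1 := (Finset.univ.filter fun i => v i ∈ H1).card with hN1
  set N2 := (Finset.univ.filter fun i => v i ∈ H2).card with hN2
  set N3 := (Finset.univ.filter fun i => v i ∈ H3).card with hN3
  have hn2 : 2 * N2 < n := h.two_mul_card_lt ⟨c, hc⟩
  have hn3 : 2 * N3 < n := h.two_mul_card_lt ⟨d, hd⟩
  have hn1 : N1 ≤ 1 := by
    rw [hN1, Finset.card_le_one]
    intro i hi j hj
    by_contra hij
    simp only [Finset.mem_filter, Finset.mem_univ, true_and] at hi hj
    have hle : Submodule.span ℂ {v i, v j} ≤ H1 := by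
      rw [Submodule.span_le]
      rintro w (rfl | rfl)
      exacts [hi, hj]
    have : FiniteDimensional ℂ H1 := FiniteDimensional.span_of_finite ℂ (Set.toFinite _)
    have h2 := Submodule.finrank_mono hle
    rw [finrank_span_pair (h.pair i j hij), hH1, finrank_span_eq_card li1] at h2
    simp at h2
  have hn2' : 2 ≤ N2 := by
    have hab' : a ≠ b := by
      rintro rfl
      exact hb (Submodule.subset_span ⟨0, rfl⟩)
    rw [← Finset.card_pair hab']
    refine Finset.card_le_card ?_
    intro i hi
    simp only [Finset.mem_insert, Finset.mem_singleton] at hi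
    simp only [Finset.mem_filter, Finset.mem_univ, true_and]
    rcases hi with rfl | rfl
    · exact Submodule.subset_span ⟨0, rfl⟩
    · exact Submodule.subset_span ⟨1, rfl⟩
  have hpt : ∀ i, l a + (if v i ∈ H1 then 0 else l b - l a) + (if v i ∈ H2 then 0 else l c - l b) +
      (if v i ∈ H3 then 0 else l d - l c) ≤ l i := by
    intro i
    by_cases h1 : v i ∈ H1
    · simpa [h1, le12 h1, le23 (le12 h1)] using hmina i
    · by_cases h2 : v i ∈ H2
      · simpa [h1, h2, le23 h2] using hbmin i h1
      · by_cases h3 : v i ∈ H3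
        · simpa [h1, h2, h3] using hcmin i h2
        · simpa [h1, h2, h3] using hdmin i h3
  have hcount : ∀ (H : Submodule ℂ U) (x : ℝ), ∑ i, (if v i ∈ H then 0 else x) =
      (n - (Finset.univ.filter fun i => v i ∈ H).card) * x := by
    intro H x
    have h1 : ∀ i, (if v i ∈ H then 0 else x) = x - if v i ∈ H then x else 0 := by
      intro i
      split_ifs <;> ring
    simp only [h1, Finset.sum_sub_distrib, ← Finset.sum_filter, Finset.sum_const, nsmul_eq_mul,
      Finset.card_univ]
    ring
  have hsum := Finset.sum_le_sum fun i (_ : i ∈ Finset.univ) => hpt i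
  simp only [Finset.sum_add_distrib, hcount, ← hN1, ← hN2, ← hN3, Finset.sum_const,
    Finset.card_univ, nsmul_eq_mul, ← hn] at hsum
  refine ⟨![a, b, c, d], li4, hmina, ?_, ?_⟩
  · intro k
    fin_cases k
    · exact hab.trans (hbc.trans hcd)
    · exact hbc.trans hcd
    · exact hcd
    · exact le_rfl
  · have e1 : (0 : ℝ) ≤ n - 4 * N1 - 1 := by
      have : 4 * N1 + 1 ≤ n := by omega
      have : (4 * N1 + 1 : ℝ) ≤ n := by exact_mod_cast this
      linarith
    have e2 : (0 : ℝ) ≤ 2 * n - 4 * N2 - 1 := by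
      have : 4 * N2 + 1 ≤ 2 * n := by omega
      have : (4 * N2 + 1 : ℝ) ≤ 2 * n := by exact_mod_cast this
      linarith
    have e3 : (0 : ℝ) ≤ 3 * n - 4 * N3 - 1 := by
      have : 4 * N3 + 1 ≤ 3 * n := by omega
      have : (4 * N3 + 1 : ℝ) ≤ 3 * n := by exact_mod_cast this
      linarith
    simp only [Fin.sum_univ_four, Matrix.cons_val]
    nlinarith [mul_nonneg e1 (sub_nonneg.mpr hab), mul_nonneg e2 (sub_nonneg.mpr hbc),
      mul_nonneg e3 (sub_nonneg.mpr hcd)]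

end IsSylvesterGallai

namespace IsSylvesterGallai

variable {ι : Type*} [Fintype ι]

local notation "E₄" => EuclideanSpace ℂ (Fin 4)

theorem exists_uniform_bound (v : ι → E₄) :
    ∃ K > (0 : ℝ), ∀ b : Fin 4 → ι, LinearIndependent ℂ (v ∘ b) → ∀ M : E₄ →L[ℂ] E₄,
      ‖M.det‖ ≤ K * ∏ k, ‖M (v (b k))‖ ∧
      ∀ R : ℝ, 0 ≤ R → (∀ k, ‖M (v (b k))‖ ≤ R) → ‖M‖ ≤ K * R := by
  set e := (EuclideanSpace.basisFun (Fin 4) ℂ).toBasis with he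
  have hcont : Continuous (e.det : (Fin 4 → E₄) → ℂ) := by
    have : (e.det : (Fin 4 → E₄) → ℂ) = fun m => (Matrix.of fun i j => m j i).det := by
      ext m
      rw [Module.Basis.det_apply]
      congr 1
    rw [this]
    refine Continuous.matrix_det (continuous_matrix fun i j => ?_)
    simp only [Matrix.of_apply]
    fun_prop
  obtain ⟨C, hC, hbound⟩ := e.det.exists_bound_of_continuous hcont
  have hex : ∀ b : Fin 4 → ι, ∃ K > (0 : ℝ), LinearIndependent ℂ (v ∘ b) → ∀ M : E₄ →L[ℂ] E₄,
      ‖M.det‖ ≤ K * ∏ k, ‖M (v (b k))‖ ∧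
      ∀ R : ℝ, 0 ≤ R → (∀ k, ‖M (v (b k))‖ ≤ R) → ‖M‖ ≤ K * R := by
    intro b
    by_cases hli : LinearIndependent ℂ (v ∘ b)
    · let β := basisOfLinearIndependentOfCardEqFinrank hli (by simp)
      have hβ : ∀ k, β k = v (b k) := fun k => by simp [β]
      obtain ⟨C', hC', hop⟩ := β.exists_opNorm_le (F := E₄)
      have hdet : e.det (v ∘ b) ≠ 0 := by
        refine isUnit_iff_ne_zero.mp ((e.is_basis_iff_det).mp ⟨hli, ?_⟩)
        exact hli.span_eq_top_of_card_eq_finrank (by simp)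
      have hpos : 0 < ‖e.det (v ∘ b)‖ := norm_pos_iff.mpr hdet
      refine ⟨max C' (C / ‖e.det (v ∘ b)‖), lt_max_of_lt_left hC', fun _ M => ⟨?_, ?_⟩⟩
      · have h1 := hbound (M ∘ (v ∘ b))
        have h2 : e.det (M ∘ (v ∘ b)) = M.det * e.det (v ∘ b) :=
          Module.Basis.det_comp e (M : E₄ →ₗ[ℂ] E₄) (v ∘ b)
        rw [h2, norm_mul] at h1
        have h3 : ‖M.det‖ ≤ C / ‖e.det (v ∘ b)‖ * ∏ k, ‖M (v (b k))‖ := by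
          rw [div_mul_eq_mul_div, le_div_iff₀ hpos]
          exact h1
        exact h3.trans (mul_le_mul_of_nonneg_right (le_max_right _ _)
          (Finset.prod_nonneg fun _ _ => norm_nonneg _))
      · intro R hR hk
        exact (hop hR fun k => by rw [hβ]; exact hk k).trans
          (mul_le_mul_of_nonneg_right (le_max_left _ _) hR)
    · exact ⟨1, one_pos, fun h => absurd h hli⟩
  choose κ hκ hκb using hex
  obtain ⟨K, hK⟩ := Finite.exists_le κ
  refine ⟨max K 1, lt_max_of_lt_right one_pos, fun b hli M => ⟨?_, fun R hR hk => ?_⟩⟩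
  · exact ((hκb b hli M).1).trans (mul_le_mul_of_nonneg_right ((hK b).trans (le_max_left _ _))
      (Finset.prod_nonneg fun _ _ => norm_nonneg _))
  · exact ((hκb b hli M).2 R hR hk).trans
      (mul_le_mul_of_nonneg_right ((hK b).trans (le_max_left _ _)) hR)

/-- The scale-invariant potential whose maximizers put `v` in radial isotropic position. -/
noncomputable def potential (v : ι → E₄) (M : E₄ →L[ℂ] E₄) : ℝ :=
  Fintype.card ι * Real.log ‖M.det‖ - 4 * ∑ i, Real.log ‖M (v i)‖

theorem apply_ne_zero_of_det_ne_zero {M : E₄ →L[ℂ] E₄} (hM : M.det ≠ 0) {x : E₄} (hx : x ≠ 0) :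
    M x ≠ 0 := by
  intro h0
  refine hM (LinearMap.det_eq_zero_iff_ker_ne_bot.mpr fun hker => hx ?_)
  have : x ∈ LinearMap.ker (M : E₄ →ₗ[ℂ] E₄) := h0
  rwa [hker, Submodule.mem_bot] at this

theorem det_smul_clm (c : ℂ) (M : E₄ →L[ℂ] E₄) : (c • M).det = c ^ 4 * M.det := by
  have := LinearMap.det_smul c (M : E₄ →ₗ[ℂ] E₄)
  rw [finrank_euclideanSpace_fin] at this
  exact this

theorem potential_smul {v : ι → E₄} (hv : ∀ i, v i ≠ 0) {c : ℂ} (hc : c ≠ 0) {M : E₄ →L[ℂ] E₄}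
    (hM : M.det ≠ 0) : potential v (c • M) = potential v M := by
  have hc' : ‖c‖ ≠ 0 := norm_ne_zero_iff.mpr hc
  have h1 : ∀ i, Real.log ‖(c • M) (v i)‖ = Real.log ‖c‖ + Real.log ‖M (v i)‖ := fun i => by
    rw [smul_apply, norm_smul,
      Real.log_mul hc' (norm_ne_zero_iff.mpr (apply_ne_zero_of_det_ne_zero hM (hv i)))]
  simp only [potential, h1, Finset.sum_add_distrib, Finset.sum_const, Finset.card_univ,
    nsmul_eq_mul]
  rw [det_smul_clm, norm_mul, norm_pow,
    Real.log_mul (pow_ne_zero _ hc') (norm_ne_zero_iff.mpr hM), Real.log_pow]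
  push_cast
  ring

variable {v : ι → E₄}

theorem vec_ne_zero {U : Type*} [AddCommGroup U] [Module ℂ U] {v : ι → U}
    (h : IsSylvesterGallai v) (hcard : 1 < Fintype.card ι) (i : ι) : v i ≠ 0 := by
  have : Nontrivial ι := Fintype.one_lt_card_iff_nontrivial.mp hcard
  obtain ⟨j, hj⟩ := exists_ne i
  exact (h.pair i j hj.symm).ne_zero 0

theorem one_lt_card (hspan : Submodule.span ℂ (Set.range v) = ⊤) : 1 < Fintype.card ι := by
  have := finrank_range_le_card (R := ℂ) v
  rw [Set.finrank, hspan, finrank_top, finrank_euclideanSpace_fin] at this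
  omega

theorem exists_le_norm_det (h : IsSylvesterGallai v) (hspan : Submodule.span ℂ (Set.range v) = ⊤)
    (P : ℝ) :
    ∃ δ > (0 : ℝ), ∀ M : E₄ →L[ℂ] E₄, M.det ≠ 0 → ‖M‖ = 1 → P ≤ potential v M → δ ≤ ‖M.det‖ := by
  obtain ⟨K, hK, hKb⟩ := exists_uniform_bound v
  have hn := one_lt_card hspan
  have hv := h.vec_ne_zero hn
  set n := Fintype.card ι with hn'
  have hnpos : (0 : ℝ) < n := by exact_mod_cast (zero_lt_one.trans hn)
  set lam : ℝ := P - Real.log K - n * Real.log K with hlam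
  refine ⟨Real.exp ((P + 4 * (n * lam)) / n), Real.exp_pos _, fun M hM hM1 hP => ?_⟩
  obtain ⟨b, hli, hmin, hmax, hsum⟩ := h.exists_greedy_basis hspan finrank_euclideanSpace_fin
    fun i => Real.log ‖M (v i)‖
  have hpos : ∀ i, 0 < ‖M (v i)‖ := fun i =>
    norm_pos_iff.mpr (apply_ne_zero_of_det_ne_zero hM (hv i))
  have hdetpos : 0 < ‖M.det‖ := norm_pos_iff.mpr hM
  obtain ⟨hdet, hop⟩ := hKb b hli M
  have hlogdet : Real.log ‖M.det‖ ≤ Real.log K + ∑ k, Real.log ‖M (v (b k))‖ := by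
    rw [← Real.log_prod fun k _ => (hpos (b k)).ne', ← Real.log_mul hK.ne'
      (Finset.prod_ne_zero_iff.mpr fun k _ => (hpos (b k)).ne')]
    exact Real.log_le_log hdetpos hdet
  have hnorm := hop ‖M (v (b 3))‖ (norm_nonneg _) fun k =>
    (Real.log_le_log_iff (hpos _) (hpos _)).mp (hmax k)
  have hlog3 : 0 ≤ Real.log K + Real.log ‖M (v (b 3))‖ := by
    rw [← Real.log_mul hK.ne' (hpos _).ne']
    exact Real.log_nonneg (hM1 ▸ hnorm)
  rw [potential, ← hn'] at hP
  have hmul := mul_le_mul_of_nonneg_left hlogdet hnpos.le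
  have hl0 : lam ≤ Real.log ‖M (v (b 0))‖ := by
    rw [hlam]
    nlinarith
  have hall : n * lam ≤ ∑ i, Real.log ‖M (v i)‖ := by
    have := Finset.card_nsmul_le_sum Finset.univ (fun i => Real.log ‖M (v i)‖) lam
      fun i _ => hl0.trans (hmin i)
    rwa [nsmul_eq_mul, Finset.card_univ] at this
  rw [← Real.le_log_iff_exp_le hdetpos, div_le_iff₀ hnpos]
  linarith

theorem exists_potential_max (h : IsSylvesterGallai v)
    (hspan : Submodule.span ℂ (Set.range v) = ⊤) :
    ∃ M₀ : E₄ →L[ℂ] E₄, M₀.det ≠ 0 ∧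
      ∀ M : E₄ →L[ℂ] E₄, M.det ≠ 0 → potential v M ≤ potential v M₀ := by
  have hv := h.vec_ne_zero (one_lt_card hspan)
  have hdet1 : (ContinuousLinearMap.id ℂ E₄).det ≠ 0 := by
    have : (ContinuousLinearMap.id ℂ E₄).det = 1 := LinearMap.det_id
    rw [this]
    exact one_ne_zero
  obtain ⟨δ, hδ, hbound⟩ := h.exists_le_norm_det hspan (potential v (ContinuousLinearMap.id ℂ E₄))
  have : ProperSpace (E₄ →L[ℂ] E₄) := FiniteDimensional.proper ℂ _
  let S : Set (E₄ →L[ℂ] E₄) := Metric.sphere 0 1 ∩ {M | δ ≤ ‖M.det‖}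
  have hScompact : IsCompact S := (isCompact_sphere 0 1).inter_right
    (isClosed_le continuous_const ContinuousLinearMap.continuous_det.norm)
  have hSdet : ∀ M ∈ S, M.det ≠ 0 := fun M hM => norm_pos_iff.mp (hδ.trans_le hM.2)
  have hnormalize : ∀ M : E₄ →L[ℂ] E₄, M.det ≠ 0 →
      potential v (ContinuousLinearMap.id ℂ E₄) ≤ potential v M →
      ∃ M' ∈ S, potential v M' = potential v M := by
    intro M hM hle
    have hM0 : M ≠ 0 := by
      rintro rfl
      obtain ⟨x, hx⟩ := exists_ne (0 : E₄)
      exact apply_ne_zero_of_det_ne_zero hM hx rfl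
    have hnM : ((‖M‖ : ℂ))⁻¹ ≠ 0 := by simpa using hM0
    have hpot := potential_smul hv hnM hM
    have hdet' : ((‖M‖ : ℂ)⁻¹ • M).det ≠ 0 := by
      rw [det_smul_clm]
      exact mul_ne_zero (pow_ne_zero _ hnM) hM
    have hn1 : ‖(‖M‖ : ℂ)⁻¹ • M‖ = 1 := by
      rw [norm_smul, norm_inv, Complex.norm_real, norm_norm]
      exact inv_mul_cancel₀ (norm_ne_zero_iff.mpr hM0)
    exact ⟨_, ⟨by simpa using hn1, hbound _ hdet' hn1 (hle.trans hpot.ge)⟩, hpot⟩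
  have hcont : ContinuousOn (potential v) S := by
    unfold potential
    refine ContinuousOn.sub (continuousOn_const.mul (ContinuousOn.log
      ContinuousLinearMap.continuous_det.norm.continuousOn fun M hM => ?_))
      (continuousOn_const.mul (continuousOn_finsetSum _ fun i _ => ContinuousOn.log
        (Continuous.continuousOn (by fun_prop)) fun M hM => ?_))
    · exact norm_ne_zero_iff.mpr (hSdet M hM)
    · exact norm_ne_zero_iff.mpr (apply_ne_zero_of_det_ne_zero (hSdet M hM) (hv i))
  obtain ⟨M₁, hM₁, hM₁eq⟩ := hnormalize _ hdet1 le_rfl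
  obtain ⟨M₀, hM₀, hmax⟩ := hScompact.exists_isMaxOn ⟨M₁, hM₁⟩ hcont
  refine ⟨M₀, hSdet M₀ hM₀, fun M hM => ?_⟩
  rcases le_total (potential v (ContinuousLinearMap.id ℂ E₄)) (potential v M) with hle | hle
  · obtain ⟨M', hM', hM'eq⟩ := hnormalize M hM hle
    exact hM'eq ▸ hmax hM'
  · exact hle.trans (hM₁eq ▸ hmax hM₁)

/-- A Sylvester–Gallai family spanning `ℂ⁴` can be put in radial isotropic position. -/
theorem exists_isotropic (h : IsSylvesterGallai v)
    (hspan : Submodule.span ℂ (Set.range v) = ⊤) :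
    ∃ M₀ : E₄ →L[ℂ] E₄, M₀.det ≠ 0 ∧ ∀ u : ι → E₄,
      (∀ i, u i = ((‖M₀ (v i)‖ : ℂ))⁻¹ • M₀ (v i)) →
      ∀ j, 4 * ∑ i, ‖inner ℂ (u i) (u j)‖ ^ 2 ≤ Fintype.card ι := by
  have hv := h.vec_ne_zero (one_lt_card hspan)
  obtain ⟨M₀, hM₀, hmax⟩ := h.exists_potential_max hspan
  refine ⟨M₀, hM₀, fun u hu j => ?_⟩
  have hpos : ∀ i, 0 < ‖M₀ (v i)‖ := fun i =>
    norm_pos_iff.mpr (apply_ne_zero_of_det_ne_zero hM₀ (hv i))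
  have hunit : ∀ i, ‖u i‖ = 1 := fun i => by
    rw [hu, norm_smul, norm_inv, Complex.norm_real, norm_norm]
    exact inv_mul_cancel₀ (hpos i).ne'
  have hMu : ∀ i, M₀ (v i) = (‖M₀ (v i)‖ : ℂ) • u i := fun i => by
    rw [hu, smul_smul, mul_inv_cancel₀ (by exact_mod_cast (hpos i).ne'), one_smul]
  set c : ι → ℝ := fun i => ‖inner ℂ (u i) (u j)‖ ^ 2 with hc
  have hc0 : ∀ i, 0 ≤ c i := fun i => sq_nonneg _
  have hc1 : ∀ i, c i ≤ 1 := fun i => by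
    have := norm_inner_le_norm (𝕜 := ℂ) (u i) (u j)
    rw [hunit, hunit, mul_one] at this
    exact pow_le_one₀ (norm_nonneg _) this
  have key : ∀ τ : ℝ, 0 < τ → τ < 1 → 4 * (1 - τ) * ∑ i, c i ≤ Fintype.card ι := by
    intro τ hτ0 hτ1
    set s := Real.sqrt (1 - τ) with hs
    have hspos : 0 < s := Real.sqrt_pos.mpr (by linarith)
    have hs2 : s ^ 2 = 1 - τ := Real.sq_sqrt (by linarith)
    let P : E₄ →L[ℂ] E₄ := ContinuousLinearMap.id ℂ E₄ +
      (((s - 1 : ℝ) : ℂ) • innerSL ℂ (u j)).smulRight (u j)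
    have hPapply : ∀ x, P x = x + (((s - 1 : ℝ) : ℂ) * inner ℂ (u j) x) • u j := fun x => by
      simp [P]
    have hPdet : P.det = s := by
      have h1 : (P : E₄ →ₗ[ℂ] E₄) = LinearMap.transvection
          ((((s - 1 : ℝ) : ℂ) • innerSL ℂ (u j) : E₄ →L[ℂ] ℂ) : E₄ →ₗ[ℂ] ℂ) (u j) := by
        ext x
        simp [P, LinearMap.transvection]
      have h2 : P.det = LinearMap.det (P : E₄ →ₗ[ℂ] E₄) := rfl
      rw [h2, h1, LinearMap.transvection.det]
      simp [hunit]
    have hPnorm : ∀ i, ‖P (u i)‖ ^ 2 = 1 - τ * c i := by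
      intro i
      have hci : c i = ‖inner ℂ (u j) (u i)‖ ^ 2 := by
        simp only [hc]
        rw [norm_inner_symm]
      rw [hPapply, norm_add_sq (𝕜 := ℂ), norm_smul, hunit, hunit, inner_smul_right,
        norm_mul, hci]
      have : ∀ z : ℂ, inner ℂ (u i) (u j) = (starRingEnd ℂ) (inner ℂ (u j) (u i)) := fun _ =>
        (inner_conj_symm _ _).symm
      rw [this 0, mul_assoc, Complex.mul_conj, Complex.normSq_eq_norm_sq, ← Complex.ofReal_mul]
      simp only [RCLike.re_to_complex, Complex.ofReal_re, Complex.norm_real, Real.norm_eq_abs,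
        mul_one, mul_pow, sq_abs]
      linear_combination (‖inner ℂ (u j) (u i)‖ ^ 2) * hs2
    have hPpos : ∀ i, 0 < ‖P (u i)‖ := fun i => by
      have : 0 < ‖P (u i)‖ ^ 2 := by
        rw [hPnorm]
        nlinarith [hc0 i, hc1 i]
      exact (norm_nonneg _).lt_of_ne' fun h0 => by simp [h0] at this
    have hcompdet : (P.comp M₀).det = s * M₀.det := by
      rw [← hPdet]
      exact LinearMap.det_comp (P : E₄ →ₗ[ℂ] E₄) (M₀ : E₄ →ₗ[ℂ] E₄)
    have hsC : (s : ℂ) ≠ 0 := by exact_mod_cast hspos.ne'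
    have hle := hmax (P.comp M₀) (by rw [hcompdet]; exact mul_ne_zero hsC hM₀)
    have hlog : ∀ i, Real.log ‖(P.comp M₀) (v i)‖ =
        Real.log ‖M₀ (v i)‖ + Real.log ‖P (u i)‖ := fun i => by
      rw [← Real.log_mul (hpos i).ne' (hPpos i).ne']
      congr 1
      rw [ContinuousLinearMap.comp_apply]
      conv_lhs => rw [hMu i]
      rw [map_smul, norm_smul, Complex.norm_real, norm_norm]
    simp only [potential, hlog, hcompdet, Finset.sum_add_distrib] at hle
    rw [norm_mul, Complex.norm_real, Real.norm_eq_abs, abs_of_pos hspos,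
      Real.log_mul hspos.ne' (norm_ne_zero_iff.mpr hM₀)] at hle
    have hPlog : ∀ i, 2 * Real.log ‖P (u i)‖ ≤ -(τ * c i) := fun i => by
      have h1 := Real.log_le_sub_one_of_pos (x := ‖P (u i)‖ ^ 2) (pow_pos (hPpos i) 2)
      rw [Real.log_pow, hPnorm] at h1
      push_cast at h1
      linarith
    have hPsum : 2 * ∑ i, Real.log ‖P (u i)‖ ≤ -(τ * ∑ i, c i) := by
      rw [Finset.mul_sum, Finset.mul_sum, ← Finset.sum_neg_distrib]
      exact Finset.sum_le_sum fun i _ => hPlog i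
    have hslog : 1 - (1 - τ)⁻¹ ≤ 2 * Real.log s := by
      have := Real.one_sub_inv_le_log_of_pos (x := s ^ 2) (pow_pos hspos 2)
      rw [Real.log_pow, hs2] at this
      exact_mod_cast this
    have hn0 : (0 : ℝ) ≤ Fintype.card ι := Nat.cast_nonneg _
    have hτ' : (0 : ℝ) < 1 - τ := by linarith
    have h1 : (Fintype.card ι : ℝ) * (1 - (1 - τ)⁻¹) ≤ Fintype.card ι * (2 * Real.log s) :=
      mul_le_mul_of_nonneg_left hslog hn0
    have h2 : 4 * (τ * ∑ i, c i) ≤ Fintype.card ι * ((1 - τ)⁻¹ - 1) := by linarith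
    have h3 : (1 - τ)⁻¹ - 1 = τ * (1 - τ)⁻¹ := by
      field_simp
      ring
    rw [h3] at h2
    have h4 : 4 * ∑ i, c i ≤ Fintype.card ι * (1 - τ)⁻¹ := by
      refine le_of_mul_le_mul_left ?_ hτ0
      linarith
    have h5 := mul_le_mul_of_nonneg_right h4 hτ'.le
    rw [mul_assoc, mul_assoc, inv_mul_cancel₀ hτ'.ne', mul_one] at h5
    linarith
  by_contra! hlt
  set tot := ∑ i, c i with htot
  have hn0 : (0 : ℝ) ≤ Fintype.card ι := Nat.cast_nonneg _
  have htot_pos : 0 < tot := by linarith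
  have hτ := key ((4 * tot - Fintype.card ι) / (8 * tot)) (div_pos (by linarith) (by linarith))
    (by rw [div_lt_one (by linarith)]; linarith)
  have : 4 * (1 - (4 * tot - Fintype.card ι) / (8 * tot)) * tot =
      4 * tot - (4 * tot - Fintype.card ι) / 2 := by
    field_simp
    ring
  linarith

end IsSylvesterGallai

namespace IsSylvesterGallai

theorem smul_map {ι U U' : Type*} [AddCommGroup U] [Module ℂ U] [AddCommGroup U'] [Module ℂ U']
    {v : ι → U} (h : IsSylvesterGallai v) {f : U →ₗ[ℂ] U'} (hf : Function.Injective f)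
    {c : ι → ℂ} (hc : ∀ i, c i ≠ 0) : IsSylvesterGallai fun i => c i • f (v i) where
  pair i j hij := by
    rw [LinearIndependent.pair_iff]
    intro s t hst
    have h0 : f ((s * c i) • v i + (t * c j) • v j) = f 0 := by
      simpa [smul_smul] using hst
    have := LinearIndependent.pair_iff.mp (h.pair i j hij) _ _ (hf h0)
    exact ⟨(mul_eq_zero.mp this.1).resolve_right (hc i),
      (mul_eq_zero.mp this.2).resolve_right (hc j)⟩
  third i j hij := by
    obtain ⟨k, hki, hkj, hk⟩ := h.third i j hij
    refine ⟨k, hki, hkj, ?_⟩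
    obtain ⟨a, b, hab⟩ := Submodule.mem_span_pair.mp hk
    refine Submodule.mem_span_pair.mpr ⟨c k * a / c i, c k * b / c j, ?_⟩
    rw [← hab, map_add, map_smul, map_smul, smul_add, smul_smul, smul_smul, smul_smul, smul_smul,
      div_mul_cancel₀ _ (hc i), div_mul_cancel₀ _ (hc j)]

theorem span_ne_top {ι : Type*} [Fintype ι] {v : ι → EuclideanSpace ℂ (Fin 4)}
    (h : IsSylvesterGallai v) : Submodule.span ℂ (Set.range v) ≠ ⊤ := by
  intro hspan
  have hcard := one_lt_card hspan
  have hv := h.vec_ne_zero hcard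
  obtain ⟨M, hM, hiso⟩ := h.exists_isotropic hspan
  have hpos : ∀ i, ‖M (v i)‖ ≠ 0 := fun i =>
    norm_ne_zero_iff.mpr (apply_ne_zero_of_det_ne_zero hM (hv i))
  have hinj : Function.Injective (M : EuclideanSpace ℂ (Fin 4) →ₗ[ℂ] EuclideanSpace ℂ (Fin 4)) := by
    rw [← LinearMap.ker_eq_bot, LinearMap.ker_eq_bot']
    intro x hx
    by_contra hx0
    exact apply_ne_zero_of_det_ne_zero hM hx0 hx
  have hle := hiso _ fun i => rfl
  have hSG := h.smul_map hinj (c := fun i => ((‖M (v i)‖ : ℂ))⁻¹)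
    fun i => inv_ne_zero (by exact_mod_cast hpos i)
  have hge := hSG.le_sum_norm_inner_sq fun i => by
    rw [norm_smul, norm_inv, Complex.norm_real, norm_norm]
    exact inv_mul_cancel₀ (hpos i)
  have hle' := Finset.sum_le_sum fun j (_ : j ∈ Finset.univ) => hle j
  rw [← Finset.mul_sum, Finset.sum_comm] at hle'
  simp only [Finset.sum_const, Finset.card_univ, nsmul_eq_mul] at hle'
  have hn : (1 : ℝ) < Fintype.card ι := by exact_mod_cast hcard
  simp only [ContinuousLinearMap.coe_coe] at hge
  nlinarith

end IsSylvesterGallai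

/-- The linear Sylvester–Gallai theorem over `ℂ` (Kelly): a finite family of nonzero vectors in
which every line spanned by two members contains a third direction spans dimension at most 3. -/
theorem finrank_span_le_three_of_sylvesterGallai {ι U : Type*} [Finite ι] [AddCommGroup U]
    [Module ℂ U] {p : ι → U} (hp : ∀ i, p i ≠ 0)
    (hSG : ∀ i j, LinearIndependent ℂ ![p i, p j] → ∃ k, p k ∈ Submodule.span ℂ {p i, p j} ∧
      LinearIndependent ℂ ![p i, p k] ∧ LinearIndependent ℂ ![p j, p k]) :
    Module.finrank ℂ (Submodule.span ℂ (Set.range p)) ≤ 3 := by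
  by_contra! hlt
  have : FiniteDimensional ℂ (Submodule.span ℂ (Set.range p)) :=
    FiniteDimensional.span_of_finite ℂ (Set.finite_range p)
  obtain ⟨f, hfmem, -, hfli⟩ := Submodule.exists_fun_fin_finrank_span_eq ℂ (Set.range p)
  choose b hb using fun k : Fin 4 => hfmem (Fin.castLE hlt k)
  have hli : LinearIndependent ℂ fun k => p (b k) := by
    have := hfli.comp _ (Fin.castLE_injective hlt)
    have heq : (fun k => p (b k)) = f ∘ Fin.castLE hlt := funext hb
    rw [heq]
    exact this
  let W := Submodule.span ℂ (Set.range fun k => p (b k))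
  have hW : Module.finrank ℂ W = 4 := by
    rw [finrank_span_eq_card hli, Fintype.card_fin]
  have : FiniteDimensional ℂ W := FiniteDimensional.span_of_finite ℂ (Set.finite_range _)
  let J := {i // p i ∈ W}
  let q : J → W := fun i => ⟨p i, i.2⟩
  have hq : ∀ i, q i ≠ 0 := fun i h0 => hp i (congrArg Subtype.val h0)
  have hqli : ∀ i j, LinearIndependent ℂ ![q i, q j] ↔ LinearIndependent ℂ ![p i, p j] := by
    intro i j
    rw [LinearIndependent.pair_iff' (hq i), LinearIndependent.pair_iff' (hp i)]
    simp only [ne_eq, Subtype.ext_iff, q, Submodule.coe_smul]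
  let pt : J → Projectivization ℂ W := fun i => Projectivization.mk ℂ (q i) (hq i)
  have hpt : ∀ i j, pt j ≠ pt i ↔ LinearIndependent ℂ ![q i, q j] := by
    intro i j
    rw [LinearIndependent.pair_iff' (hq i), ne_eq, Projectivization.mk_eq_mk_iff', not_exists]
  let T := Set.range pt
  choose s hs using fun x : T => x.2
  have hTfin : Finite T := Set.finite_range pt
  have := Fintype.ofFinite T
  have hv : IsSylvesterGallai fun x : T => q (s x) := by
    refine ⟨fun x y hxy => ?_, fun x y hxy => ?_⟩
    · rw [← hpt, hs, hs]
      exact fun h => hxy (Subtype.ext h.symm)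
    · have hxy' : pt (s y) ≠ pt (s x) := by
        rw [hs, hs]
        exact fun h => hxy (Subtype.ext h.symm)
      obtain ⟨k, hk, hk1, hk2⟩ := hSG _ _ ((hqli _ _).mp ((hpt _ _).mp hxy'))
      have hkW : p k ∈ W := by
        refine Submodule.span_le.mpr ?_ hk
        rintro z (rfl | rfl)
        exacts [(s x).2, (s y).2]
      let k' : J := ⟨k, hkW⟩
      have hne : ∀ z : T, LinearIndependent ℂ ![p (s z), p k] → (⟨pt k', k', rfl⟩ : T) ≠ z := by
        rintro z hz h
        refine (hpt (s z) k').mpr ((hqli _ _).mpr hz) ?_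
        rw [hs, ← h]
      refine ⟨⟨pt k', k', rfl⟩, hne x hk1, hne y hk2, ?_⟩
      set z : T := ⟨pt k', k', rfl⟩ with hz
      obtain ⟨c, hc⟩ := (Projectivization.mk_eq_mk_iff' ℂ (q (s z)) (q k') (hq _) (hq _)).mp (hs z)
      rw [← hc]
      refine Submodule.smul_mem _ _ ?_
      obtain ⟨α, β, hαβ⟩ := Submodule.mem_span_pair.mp hk
      exact Submodule.mem_span_pair.mpr ⟨α, β, Subtype.ext hαβ⟩
  let e : W ≃ₗ[ℂ] EuclideanSpace ℂ (Fin 4) := LinearEquiv.ofFinrankEq _ _ (by simp [hW])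
  have hSG' := hv.smul_map (f := e.toLinearMap) e.injective (c := fun _ => 1) fun _ => one_ne_zero
  refine hSG'.span_ne_top ?_
  have hspan : Submodule.span ℂ (Set.range fun x : T => q (s x)) = ⊤ := by
    rw [eq_top_iff]
    have hall : ∀ i : J, q i ∈ Submodule.span ℂ (Set.range fun x : T => q (s x)) := by
      intro i
      set z : T := ⟨pt i, i, rfl⟩ with hz
      obtain ⟨c, hc⟩ := (Projectivization.mk_eq_mk_iff' ℂ (q i) (q (s z)) (hq _) (hq _)).mp
        (hs z).symm
      rw [← hc]
      exact Submodule.smul_mem _ _ (Submodule.subset_span ⟨z, rfl⟩)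
    have hW' : W ≤ (Submodule.span ℂ (Set.range fun x : T => q (s x))).map W.subtype := by
      refine Submodule.span_le.mpr ?_
      rintro _ ⟨k, rfl⟩
      exact ⟨_, hall ⟨b k, Submodule.subset_span ⟨k, rfl⟩⟩, rfl⟩
    rintro ⟨w, hw⟩ -
    obtain ⟨w', hw', hww⟩ := hW' hw
    have : w' = ⟨w, hw⟩ := Subtype.ext hww
    rwa [← this]
  have : (Set.range fun x : T => (1 : ℂ) • e.toLinearMap (q (s x))) =
      e.toLinearMap '' Set.range fun x : T => q (s x) := by
    rw [← Set.range_comp]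
    exact congrArg Set.range (funext fun x => one_smul _ _)
  rw [this, ← Submodule.map_span, hspan, Submodule.map_top, LinearMap.range_eq_top]
  exact e.surjective

/-- The polarization `w ↦ ∑ⱼ wⱼ ∂ⱼQ` of a polynomial `Q`. -/
noncomputable def polarForm {n : ℕ} (Q : MvPolynomial (Fin n) ℂ) :
    (Fin n → ℂ) →ₗ[ℂ] MvPolynomial (Fin n) ℂ :=
  ∑ j, (LinearMap.proj j).smulRight (pderiv j Q)

section Polar

variable {n : ℕ} {Q Q' a b : MvPolynomial (Fin n) ℂ}

theorem polarForm_apply (Q : MvPolynomial (Fin n) ℂ) (w : Fin n → ℂ) :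
    polarForm Q w = ∑ j, w j • pderiv j Q := by
  simp [polarForm]

theorem polarForm_add (Q Q' : MvPolynomial (Fin n) ℂ) :
    polarForm (Q + Q') = polarForm Q + polarForm Q' := by
  refine LinearMap.ext fun w => ?_
  simp [polarForm_apply, Finset.sum_add_distrib]

theorem polarForm_smul (c : ℂ) (Q : MvPolynomial (Fin n) ℂ) :
    polarForm (c • Q) = c • polarForm Q := by
  refine LinearMap.ext fun w => ?_
  simp [polarForm_apply, Finset.smul_sum, smul_comm c]

theorem eval_linearForm_add (ha : a.IsHomogeneous 1) (x y : Fin n → ℂ) :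
    eval (x + y) a = eval x a + eval y a := by
  rw [← mem_homogeneousSubmodule, homogeneousSubmodule_one_eq_span_X] at ha
  induction ha using Submodule.span_induction with
  | mem p hp => obtain ⟨i, rfl⟩ := hp; simp
  | zero => simp
  | add p q _ _ hp hq => simp only [map_add, hp, hq]; ring
  | smul c p _ hp => simp only [smul_eval, hp]; ring

theorem eval_linearForm_smul (ha : a.IsHomogeneous 1) (c : ℂ) (x : Fin n → ℂ) :
    eval (c • x) a = c * eval x a := by
  rw [← mem_homogeneousSubmodule, homogeneousSubmodule_one_eq_span_X] at ha
  induction ha using Submodule.span_induction with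
  | mem p hp => obtain ⟨i, rfl⟩ := hp; simp
  | zero => simp
  | add p q _ _ hp hq => simp only [map_add, hp, hq]; ring
  | smul c p _ hp => simp only [smul_eval, hp]; ring

/-- The linear functional on `ℂⁿ` defined by a linear form. -/
noncomputable def linearFormEval (ha : a.IsHomogeneous 1) : (Fin n → ℂ) →ₗ[ℂ] ℂ where
  toFun x := eval x a
  map_add' := eval_linearForm_add ha
  map_smul' := eval_linearForm_smul ha

theorem polarForm_linearForm (ha : a.IsHomogeneous 1) (w : Fin n → ℂ) :
    polarForm a w = C (eval w a) := by
  rw [← mem_homogeneousSubmodule, homogeneousSubmodule_one_eq_span_X] at ha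
  induction ha using Submodule.span_induction with
  | mem p hp =>
    obtain ⟨i, rfl⟩ := hp
    simp [polarForm_apply, pderiv_X, Pi.single_apply, smul_eq_C_mul]
  | zero => simp [polarForm_apply]
  | add p q _ _ hp hq => simp [polarForm_add, hp, hq]
  | smul c p _ hp => rw [polarForm_smul, LinearMap.smul_apply, hp, smul_eval, map_mul, smul_eq_C_mul]

theorem polarForm_mul (ha : a.IsHomogeneous 1) (hb : b.IsHomogeneous 1) (w : Fin n → ℂ) :
    polarForm (a * b) w = C (eval w b) * a + C (eval w a) * b := by
  rw [← polarForm_linearForm ha, ← polarForm_linearForm hb]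
  simp only [polarForm_apply, pderiv_mul, smul_add, Finset.sum_add_distrib, Finset.sum_mul]
  rw [add_comm]
  congr 1 <;> refine Finset.sum_congr rfl fun j _ => ?_
  · rw [smul_mul_assoc, mul_comm]
  · rw [smul_mul_assoc]

/-- Quadratic forms are sums of products of two linear forms. -/
theorem quadratic_induction {P : MvPolynomial (Fin n) ℂ → Prop} (hQ : Q.IsHomogeneous 2)
    (hmul : ∀ a b : MvPolynomial (Fin n) ℂ, a.IsHomogeneous 1 → b.IsHomogeneous 1 → P (a * b))
    (hadd : ∀ p q, P p → P q → P (p + q)) : P Q := by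
  rw [← mem_homogeneousSubmodule, ← homogeneousSubmodule_one_pow, sq] at hQ
  exact Submodule.mul_induction_on hQ (fun a ha b hb => hmul a b ha hb) hadd

theorem polarForm_isHomogeneous (hQ : Q.IsHomogeneous 2) (w : Fin n → ℂ) :
    (polarForm Q w).IsHomogeneous 1 := by
  refine quadratic_induction (P := fun Q => (polarForm Q w).IsHomogeneous 1) hQ
    (fun a b ha hb => ?_) fun p q hp hq => ?_
  · rw [polarForm_mul ha hb]
    exact ((isHomogeneous_C _ _).mul ha).add ((isHomogeneous_C _ _).mul hb)
  · rw [polarForm_add]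
    exact hp.add hq

theorem eval_polarForm_comm (hQ : Q.IsHomogeneous 2) (x w : Fin n → ℂ) :
    eval x (polarForm Q w) = eval w (polarForm Q x) := by
  refine quadratic_induction (P := fun Q => eval x (polarForm Q w) = eval w (polarForm Q x)) hQ
    (fun a b ha hb => ?_) fun p q hp hq => ?_
  · simp only [polarForm_mul ha hb, map_add, map_mul, eval_C]
    ring
  · simp only [polarForm_add, LinearMap.add_apply, map_add, hp, hq]

theorem eval_polarForm_self (hQ : Q.IsHomogeneous 2) (x : Fin n → ℂ) :
    eval x (polarForm Q x) = 2 * eval x Q := by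
  refine quadratic_induction (P := fun Q => eval x (polarForm Q x) = 2 * eval x Q) hQ
    (fun a b ha hb => ?_) fun p q hp hq => ?_
  · simp only [polarForm_mul ha hb, map_add, map_mul, eval_C]
    ring
  · simp only [polarForm_add, LinearMap.add_apply, map_add, hp, hq]
    ring

theorem eval_add_of_quadratic (hQ : Q.IsHomogeneous 2) (x w : Fin n → ℂ) :
    eval (x + w) Q = eval x Q + eval x (polarForm Q w) + eval w Q := by
  refine quadratic_induction (P := fun Q => eval (x + w) Q = eval x Q + eval x (polarForm Q w) + eval w Q) hQ
    (fun a b ha hb => ?_) fun p q hp hq => ?_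
  · simp only [polarForm_mul ha hb, map_add, map_mul, eval_C, eval_linearForm_add ha,
      eval_linearForm_add hb]
    ring
  · simp only [polarForm_add, LinearMap.add_apply, map_add, hp, hq]
    ring

theorem eval_add_smul_of_quadratic (hQ : Q.IsHomogeneous 2) (x w : Fin n → ℂ) (t : ℂ) :
    eval (x + t • w) Q = eval x Q + t * eval x (polarForm Q w) + t ^ 2 * eval w Q := by
  have h := eval_polarForm_self hQ (t • w)
  rw [map_smul, smul_eval, eval_linearForm_smul (polarForm_isHomogeneous hQ w),
    eval_polarForm_self hQ] at h
  rw [eval_add_of_quadratic hQ, map_smul, smul_eval]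
  linear_combination -h / 2

theorem pderiv_mem_MS (Q : MvPolynomial (Fin n) ℂ) (j : Fin n) : pderiv j Q ∈ MS Q := by
  rw [MS, Submodule.mem_sInf]
  rintro _ ⟨a, b, ha, hb, hQ, rfl⟩
  have hC : ∀ c : MvPolynomial (Fin n) ℂ, c.IsHomogeneous 1 → ∃ z : ℂ, pderiv j c = C z :=
    fun c hc => ⟨_, by
      have := polarForm_linearForm hc (Pi.single j 1)
      rwa [polarForm_apply, Finset.sum_eq_single j (by
        intro k _ hk
        simp [hk]) (by simp), Pi.single_eq_same, one_smul] at this⟩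
  have hsum := congrArg (pderiv j) hQ
  rw [map_sum] at hsum
  rw [hsum]
  refine Submodule.sum_mem _ fun i _ => ?_
  obtain ⟨z, hz⟩ := hC _ (ha i)
  obtain ⟨z', hz'⟩ := hC _ (hb i)
  rw [pderiv_mul, hz, hz', mul_comm (a i), ← smul_eq_C_mul, ← smul_eq_C_mul]
  exact add_mem (Submodule.smul_mem _ _ (Submodule.subset_span (Or.inr ⟨i, rfl⟩)))
    (Submodule.smul_mem _ _ (Submodule.subset_span (Or.inl ⟨i, rfl⟩)))

theorem polarForm_eq_zero_of_MS_le (hQ : Q.IsHomogeneous 2)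
    {V : Submodule ℂ (MvPolynomial (Fin n) ℂ)} (hMS : MS Q ≤ V ⊔ Submodule.span ℂ {a})
    {w : Fin n → ℂ} (hV : ∀ v ∈ V, eval w v = 0) (hw : eval w a = 0) : polarForm Q w = 0 := by
  refine MvPolynomial.funext fun x => ?_
  have hle : V ⊔ Submodule.span ℂ {a} ≤ LinearMap.ker (aeval w : _ →ₐ[ℂ] ℂ).toLinearMap := by
    refine sup_le (fun v hv => ?_) ?_
    · simpa [aeval_eq_eval] using hV v hv
    · rw [Submodule.span_singleton_le_iff_mem]
      simpa [aeval_eq_eval] using hw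
  rw [eval_polarForm_comm hQ, polarForm_apply, map_sum, map_zero]
  refine Finset.sum_eq_zero fun j _ => ?_
  have := hle (hMS (pderiv_mem_MS Q j))
  rw [smul_eval, show eval w (pderiv j Q) = 0 by simpa [aeval_eq_eval] using this, mul_zero]

end Polar

section Resultant

variable {n : ℕ}

theorem eq_C_mul_of_dvd {d : ℕ} {p q : MvPolynomial (Fin n) ℂ} (hp : p.IsHomogeneous d)
    (hq : q.IsHomogeneous d) (hq0 : q ≠ 0) (h : p ∣ q) : ∃ c : ℂ, c ≠ 0 ∧ q = C c * p := by
  obtain ⟨r, rfl⟩ := h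
  have hp0 := left_ne_zero_of_mul hq0
  have hr0 := right_ne_zero_of_mul hq0
  have hdeg := totalDegree_mul_of_isDomain hp0 hr0
  rw [hq.totalDegree hq0, hp.totalDegree hp0] at hdeg
  have hr : r = C (r.coeff 0) := totalDegree_eq_zero_iff_eq_C.mp (by omega)
  refine ⟨r.coeff 0, fun h0 => hr0 ?_, ?_⟩
  · rw [hr, h0, map_zero]
  · rw [mul_comm p]
    conv_lhs => rw [hr]

theorem not_dvd_of_linearIndependent {d : ℕ} {p q : MvPolynomial (Fin n) ℂ}
    (hp : p.IsHomogeneous d) (hq : q.IsHomogeneous d) (h : LinearIndependent ℂ ![p, q]) :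
    ¬ p ∣ q := by
  intro hdvd
  have hq0 : q ≠ 0 := h.ne_zero 1
  obtain ⟨c, -, hc⟩ := eq_C_mul_of_dvd hp hq hq0 hdvd
  have := LinearIndependent.pair_iff.mp h c (-1) (by rw [hc, smul_eq_C_mul, neg_one_smul]; ring)
  exact neg_ne_zero.mpr one_ne_zero this.2

theorem not_isUnit_of_isHomogeneous {d : ℕ} (hd : d ≠ 0) {p : MvPolynomial (Fin n) ℂ}
    (hp : p.IsHomogeneous d) : ¬ IsUnit p := by
  intro hu
  have h0 := (isUnit_iff_totalDegree_of_isReduced.mp hu).2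
  rw [hp.totalDegree hu.ne_zero] at h0
  exact hd h0

theorem isRelPrime_of_linearIndependent {p q : MvPolynomial (Fin n) ℂ}
    (hp : p.IsHomogeneous 2) (hq : q.IsHomogeneous 2) (h : LinearIndependent ℂ ![p, q])
    (hp' : Irreducible p ∨ ∃ l : MvPolynomial (Fin n) ℂ, l.IsHomogeneous 1 ∧ p = l ^ 2)
    (hq' : Irreducible q ∨ ∃ l : MvPolynomial (Fin n) ℂ, l.IsHomogeneous 1 ∧ q = l ^ 2) :
    IsRelPrime p q := by
  rcases hp' with hp' | ⟨l, hl, rfl⟩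
  · exact hp'.isRelPrime_iff_not_dvd.mpr (not_dvd_of_linearIndependent hp hq h)
  rcases hq' with hq' | ⟨l', hl', rfl⟩
  · refine (hq'.isRelPrime_iff_not_dvd.mpr (not_dvd_of_linearIndependent hq hp ?_)).symm
    exact LinearIndependent.pair_symm_iff.mp h
  have hl0 : l ≠ 0 := fun h0 => h.ne_zero 0 (by simp [h0])
  have hl0' : l' ≠ 0 := fun h0 => h.ne_zero 1 (by simp [h0])
  have hirr : Irreducible l := by
    refine ⟨not_isUnit_of_isHomogeneous one_ne_zero hl, fun r s hrs => ?_⟩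
    have hr : r ≠ 0 := fun h0 => hl0 (by rw [hrs, h0, zero_mul])
    have hs : s ≠ 0 := fun h0 => hl0 (by rw [hrs, h0, mul_zero])
    have hdeg := totalDegree_mul_of_isDomain hr hs
    rw [← hrs, hl.totalDegree hl0] at hdeg
    have hunit : ∀ z : MvPolynomial (Fin n) ℂ, z ≠ 0 → z.totalDegree = 0 → IsUnit z := by
      intro z hz h0
      rw [totalDegree_eq_zero_iff_eq_C] at h0
      rw [h0] at hz ⊢
      exact (isUnit_iff_ne_zero.mpr fun h1 => hz (by rw [h1, map_zero])).map C
    rcases (by omega : r.totalDegree = 0 ∨ s.totalDegree = 0) with h0 | h0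
    · exact Or.inl (hunit r hr h0)
    · exact Or.inr (hunit s hs h0)
  refine IsRelPrime.pow (hirr.isRelPrime_iff_not_dvd.mpr fun hdvd => ?_)
  obtain ⟨c, -, hc⟩ := eq_C_mul_of_dvd hl hl' hl0' hdvd
  have := LinearIndependent.pair_iff.mp h (c ^ 2) (-1) (by
    rw [hc, smul_eq_C_mul, neg_one_smul, map_pow]
    ring)
  exact neg_ne_zero.mpr one_ne_zero this.2

/-- Two coprime quadratics whose restrictions to lines in direction `w` have no constant member
have no common zero on the line through a generic point. -/
theorem exists_resultant_of_eval_eq_zero {F G : MvPolynomial (Fin n) ℂ} (hF : F.IsHomogeneous 2)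
    (hG : G.IsHomogeneous 2) (hFG : IsRelPrime F G) {w : Fin n → ℂ} (hF0 : eval w F = 0)
    (hG0 : eval w G = 0) (hF1 : polarForm F w ≠ 0) :
    ∃ R : MvPolynomial (Fin n) ℂ, R ≠ 0 ∧ ∀ (x : Fin n → ℂ) (t : ℂ),
      eval (x + t • w) F = 0 → eval (x + t • w) G = 0 → eval x R = 0 := by
  refine ⟨polarForm G w * F - G * polarForm F w, fun h0 => ?_, fun x t h1 h2 => ?_⟩
  · have hdvd : F ∣ polarForm F w :=
      hFG.dvd_of_dvd_mul_left ⟨polarForm G w, by linear_combination -h0⟩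
    have hle := totalDegree_le_of_dvd_of_isDomain hdvd hF1
    have hFne : F ≠ 0 := fun h => hF1 (by simp [h, polarForm_apply])
    rw [hF.totalDegree hFne, (polarForm_isHomogeneous hF w).totalDegree hF1] at hle
    omega
  · rw [eval_add_smul_of_quadratic hF, hF0] at h1
    rw [eval_add_smul_of_quadratic hG, hG0] at h2
    simp only [map_sub, map_mul]
    linear_combination eval x (polarForm G w) * h1 - eval x (polarForm F w) * h2

theorem exists_resultant_of_eval_ne_zero {F G : MvPolynomial (Fin n) ℂ} (hF : F.IsHomogeneous 2)
    (hG : G.IsHomogeneous 2) (hFG : IsRelPrime F G) {w : Fin n → ℂ} (hF0 : eval w F ≠ 0) :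
    ∃ R : MvPolynomial (Fin n) ℂ, R ≠ 0 ∧ ∀ (x : Fin n → ℂ) (t : ℂ),
      eval (x + t • w) F = 0 → eval (x + t • w) G = 0 → eval x R = 0 := by
  set c := eval w F with hc
  set d := eval w G with hd
  set G' := C c * G - C d * F with hG'
  have hFne : F ≠ 0 := fun h => hF0 (by rw [hc, h, map_zero])
  have hcunit : IsUnit (C c : MvPolynomial (Fin n) ℂ) := (isUnit_iff_ne_zero.mpr hF0).map C
  have hG'hom : G'.IsHomogeneous 2 :=
    ((isHomogeneous_C _ c).mul hG).sub ((isHomogeneous_C _ d).mul hF)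
  have hrel : IsRelPrime F G' := fun z hz1 hz2 => by
    refine hFG hz1 (hcunit.dvd_mul_left.mp ?_)
    have : C c * G = G' + C d * F := by rw [hG']; ring
    rw [this]
    exact dvd_add hz2 (dvd_mul_of_dvd_right hz1 _)
  have hG'ne : G' ≠ 0 := fun h0 => by
    rw [h0] at hrel
    exact not_isUnit_of_isHomogeneous two_ne_zero hF (hrel dvd_rfl (dvd_zero _))
  have hG'w : eval w G' = 0 := by
    simp only [hG', map_sub, map_mul, eval_C, ← hc, ← hd]
    ring
  set g := polarForm G' w with hg
  have hghom : g.IsHomogeneous 1 := polarForm_isHomogeneous hG'hom w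
  set f := polarForm F w with hf
  refine ⟨g ^ 2 * F - g * G' * f + G' ^ 2 * C c, fun h0 => ?_, fun x t h1 h2 => ?_⟩
  · have hgne : g ≠ 0 := fun hg0 => by
      rw [hg0] at h0
      refine mul_ne_zero (pow_ne_zero 2 hG'ne) hcunit.ne_zero ?_
      linear_combination h0
    have hdvd : G' ∣ g ^ 2 :=
      hrel.symm.dvd_of_dvd_mul_right ⟨g * f - G' * C c, by linear_combination h0⟩
    have hg2 : (g ^ 2).IsHomogeneous 2 := hghom.pow 2
    obtain ⟨e, he0, he⟩ := eq_C_mul_of_dvd hG'hom hg2 (pow_ne_zero 2 hgne) hdvd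
    have heunit : IsUnit (C e : MvPolynomial (Fin n) ℂ) := (isUnit_iff_ne_zero.mpr he0).map C
    have hgG : g ∣ G' := heunit.dvd_mul_left.mp (he ▸ dvd_pow_self g two_ne_zero)
    have hcancel : C e * F = g * f - G' * C c := by
      refine mul_left_cancel₀ hG'ne ?_
      linear_combination h0 - F * he
    have hgF : g ∣ F := by
      refine heunit.dvd_mul_left.mp ?_
      rw [hcancel]
      exact dvd_sub (dvd_mul_right _ _) (dvd_mul_of_dvd_left hgG _)
    exact not_isUnit_of_isHomogeneous one_ne_zero hghom (hrel hgF hgG)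
  · have h3 : eval (x + t • w) G' = 0 := by
      simp only [hG', map_sub, map_mul, h1, h2, mul_zero, sub_zero]
    rw [eval_add_smul_of_quadratic hF] at h1
    rw [eval_add_smul_of_quadratic hG'hom, hG'w] at h3
    simp only [map_sub, map_mul, map_add, map_pow, eval_C]
    have h4 : eval x G' = -(t * eval x g) := by linear_combination h3
    rw [h4]
    linear_combination (eval x g) ^ 2 * h1

theorem exists_resultant {F G : MvPolynomial (Fin n) ℂ} (hF : F.IsHomogeneous 2)
    (hG : G.IsHomogeneous 2) (hFG : IsRelPrime F G) {w : Fin n → ℂ} (hF1 : polarForm F w ≠ 0) :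
    ∃ R : MvPolynomial (Fin n) ℂ, R ≠ 0 ∧ ∀ (x : Fin n → ℂ) (t : ℂ),
      eval (x + t • w) F = 0 → eval (x + t • w) G = 0 → eval x R = 0 := by
  by_cases hF0 : eval w F = 0
  · by_cases hG0 : eval w G = 0
    · exact exists_resultant_of_eval_eq_zero hF hG hFG hF0 hG0 hF1
    · obtain ⟨R, hR, h⟩ := exists_resultant_of_eval_ne_zero hG hF hFG.symm hG0
      exact ⟨R, hR, fun x t h1 h2 => h x t h2 h1⟩
  · exact exists_resultant_of_eval_ne_zero hF hG hFG hF0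

end Resultant

/-- A subspace contains a vector avoiding the kernels of finitely many linear maps which do not
vanish identically on it. -/
theorem exists_mem_forall_apply_ne_zero {κ E M : Type*} [Finite κ] [AddCommGroup E] [Module ℂ E]
    [AddCommGroup M] [Module ℂ M] (D : Submodule ℂ E) (L : κ → E →ₗ[ℂ] M) :
    ∃ d ∈ D, ∀ k, ¬ D ≤ LinearMap.ker (L k) → L k d ≠ 0 := by
  by_contra! h
  obtain ⟨⟨k, hk⟩, hk'⟩ := Subspace.exists_eq_top_of_iUnion_eq_univ
    (p := fun k : {k // ¬ D ≤ LinearMap.ker (L k)} => (LinearMap.ker (L k)).comap D.subtype) (by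
      refine Set.eq_univ_of_forall fun d => ?_
      obtain ⟨k, hk, h0⟩ := h d d.2
      exact Set.mem_iUnion.mpr ⟨⟨k, hk⟩, h0⟩)
  refine hk fun x hx => ?_
  have : (⟨x, hx⟩ : D) ∈ (LinearMap.ker (L k)).comap D.subtype := by
    rw [hk']
    trivial
  exact this

/-- A family of affine hyperplane arrangements `{p i ∈ Z i}`, all transverse to `w₀` and without
common points along it, in which every intersection of two members is covered by the others,
has normals spanning dimension at most 3. -/
theorem finrank_span_le_three_of_cover {ι N : Type*} [Finite ι] [AddCommGroup N] [Module ℂ N]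
    {w₀ : N} {p : ι → Module.Dual ℂ N} (hp : ∀ i, p i w₀ = 1) {Z : ι → Set ℂ}
    (hfin : ∀ i, (Z i).Finite) (hne : ∀ i, (Z i).Nonempty)
    (hdisj : ∀ i j, i ≠ j → Disjoint (Z i) (Z j))
    (hcover : ∀ i j, i ≠ j → ∀ w, p i w ∈ Z i → p j w ∈ Z j →
      ∃ k, k ≠ i ∧ k ≠ j ∧ p k w ∈ Z k) :
    Module.finrank ℂ (Submodule.span ℂ (Set.range p)) ≤ 3 := by
  have hli : ∀ i j, p i ≠ p j → LinearIndependent ℂ ![p i, p j] := by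
    intro i j hij
    rw [LinearIndependent.pair_iff]
    intro s t hst
    have h0 := LinearMap.congr_fun hst w₀
    simp only [LinearMap.add_apply, LinearMap.smul_apply, hp, smul_eq_mul, mul_one,
      LinearMap.zero_apply] at h0
    have ht : t = -s := by linear_combination h0
    rw [ht, neg_smul, ← sub_eq_add_neg, ← smul_sub, smul_eq_zero] at hst
    have hs := hst.resolve_right (sub_ne_zero.mpr hij)
    exact ⟨hs, by rw [ht, hs, neg_zero]⟩
  refine finrank_span_le_three_of_sylvesterGallai (fun i h0 => ?_) fun i j hij => ?_
  · have := hp i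
    rw [h0, LinearMap.zero_apply] at this
    exact zero_ne_one this
  have hijne : p i ≠ p j := fun h => by
    have := LinearIndependent.pair_iff.mp hij 1 (-1) (by rw [h]; simp)
    exact one_ne_zero this.1
  have hne' : i ≠ j := fun h => hijne (by rw [h])
  obtain ⟨si, hsi⟩ := hne i
  obtain ⟨sj, hsj⟩ := hne j
  -- a point of the flat `p i = si`, `p j = sj`
  obtain ⟨w, hwi, hwj⟩ : ∃ w, p i w = si ∧ p j w = sj := by
    obtain ⟨y, hy⟩ : ∃ y, p i y ≠ p j y := by
      by_contra! h
      exact hijne (LinearMap.ext h)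
    set z := y - (p i y) • w₀ with hz
    have hzi : p i z = 0 := by simp [hz, hp]
    have hzj : p j z ≠ 0 := by
      simp only [hz, map_sub, map_smul, hp, smul_eq_mul, mul_one]
      exact sub_ne_zero.mpr hy.symm
    refine ⟨si • w₀ + ((sj - si) / p j z) • z, ?_, ?_⟩
    · simp [hp, hzi]
    · simp only [map_add, map_smul, hp, smul_eq_mul, mul_one, div_mul_cancel₀ _ hzj]
      ring
  let D : Submodule ℂ N := LinearMap.ker (p i) ⊓ LinearMap.ker (p j)
  obtain ⟨d, hdD, hd⟩ := exists_mem_forall_apply_ne_zero D p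
  have hdi : p i d = 0 := hdD.1
  have hdj : p j d = 0 := hdD.2
  -- all but finitely many points `w + t • d` avoid the hyperplanes not containing `D`
  have hbad : (⋃ k ∈ {k | p k d ≠ 0}, (fun t : ℂ => p k w + t * p k d) ⁻¹' Z k).Finite := by
    refine Set.Finite.biUnion (Set.toFinite _) fun k hk => (hfin k).preimage ?_
    intro t _ t' _ htt
    simpa using mul_right_cancel₀ hk (add_left_cancel htt)
  obtain ⟨t, ht⟩ := hbad.exists_notMem
  obtain ⟨k, hki, hkj, hk⟩ := hcover i j hne' (w + t • d) (by simp [hdi, hwi, hsi])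
    (by simp [hdj, hwj, hsj])
  have hkd : p k d = 0 := by
    by_contra h
    exact ht (Set.mem_biUnion h (by simpa using hk))
  have hDk : D ≤ LinearMap.ker (p k) := by
    by_contra h
    exact hd k h hkd
  have hkw : p k w ∈ Z k := by simpa [hkd] using hk
  refine ⟨k, ?_, hli i k fun h => ?_, hli j k fun h => ?_⟩
  · have hmem := mem_span_of_iInf_ker_le_ker (L := ![p i, p j]) (K := p k) (by
      refine le_trans (fun x hx => ?_) hDk
      rw [Submodule.mem_iInf] at hx
      exact ⟨hx 0, hx 1⟩)
    rwa [Matrix.range_cons_cons_empty] at hmem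
  · exact Set.disjoint_left.mp (hdisj i k hki.symm) (hwi ▸ hsi) (h ▸ hkw)
  · exact Set.disjoint_left.mp (hdisj j k hkj.symm) (hwj ▸ hsj) (h ▸ hkw)

section Generic

variable {n : ℕ}

theorem exists_normalized_functional {Q : MvPolynomial (Fin n) ℂ} (hQ : Q.IsHomogeneous 2)
    {N : Submodule ℂ (Fin n → ℂ)}
    (htype : (∀ w ∈ N, eval w Q = 0) ∨
      ∃ a : (Fin n → ℂ) →ₗ[ℂ] ℂ, ∀ w ∈ N, a w = 0 → polarForm Q w = 0)
    {w₀ : N} {x : Fin n → ℂ} (hx : eval x (polarForm Q w₀) ≠ 0) :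
    ∃ p : Module.Dual ℂ N, p w₀ = 1 ∧
      (∀ w : N, eval x (polarForm Q w) = p w * eval x (polarForm Q w₀)) ∧
      ∀ w w' : N, eval (w' : Fin n → ℂ) (polarForm Q w) =
        p w * p w' * eval (w₀ : Fin n → ℂ) (polarForm Q w₀) := by
  let p : Module.Dual ℂ N :=
    (eval x (polarForm Q w₀))⁻¹ • ((aeval x).toLinearMap ∘ₗ polarForm Q ∘ₗ N.subtype)
  have hp : ∀ w, p w = (eval x (polarForm Q w₀))⁻¹ * eval x (polarForm Q w) := fun w => by
    simp [p, aeval_eq_eval]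
  have hp1 : ∀ w : N, eval x (polarForm Q w) = p w * eval x (polarForm Q w₀) := fun w => by
    rw [hp]
    field_simp
  refine ⟨p, by rw [hp, inv_mul_cancel₀ hx], hp1, fun w w' => ?_⟩
  rcases htype with hA | ⟨a, ha⟩
  · have hzero : ∀ y z : N, eval (z : Fin n → ℂ) (polarForm Q y) = 0 := fun y z => by
      have h1 := eval_add_of_quadratic hQ (z : Fin n → ℂ) y
      rw [hA _ z.2, hA _ y.2, hA _ (N.add_mem z.2 y.2)] at h1
      linear_combination -h1
    rw [hzero, hzero, mul_zero]
  · have ha0 : a w₀ ≠ 0 := fun h0 => hx (by rw [ha _ w₀.2 h0, map_zero])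
    have hprop : ∀ y : N, polarForm Q y = p y • polarForm Q w₀ := fun y => by
      have h0 := ha _ (y - (a y / a w₀) • w₀).2 (by
        simp [div_mul_cancel₀ _ ha0])
      simp only [Submodule.coe_sub, Submodule.coe_smul, map_sub, map_smul, sub_eq_zero] at h0
      have hpy : p y = a y / a w₀ := by
        rw [hp, h0, smul_eval]
        field_simp
      rw [h0, hpy]
    rw [hprop w, smul_eval, eval_polarForm_comm hQ, hprop w', smul_eval]
    ring

theorem exists_fin_span_ge {E : Type*} [AddCommGroup E] [Module ℂ E] {C : Submodule ℂ E}
    [FiniteDimensional ℂ C] {d : ℕ} (hd : Module.finrank ℂ C ≤ d) :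
    ∃ u : Fin d → E, (∀ q, u q ∈ C) ∧ C ≤ Submodule.span ℂ (Set.range u) := by
  let b := Module.finBasis ℂ C
  refine ⟨fun q => if h : q.1 < Module.finrank ℂ C then (b ⟨q, h⟩ : E) else 0, fun q => ?_, ?_⟩
  · dsimp only
    split_ifs
    exacts [Subtype.mem _, C.zero_mem]
  · intro x hx
    have hmem := b.mem_span (⟨x, hx⟩ : C)
    have := Submodule.mem_map_of_mem (f := C.subtype) hmem
    rw [Submodule.map_span, ← Set.range_comp] at this
    refine Submodule.span_mono ?_ this
    rintro _ ⟨k, rfl⟩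
    exact ⟨Fin.castLE hd k, by simp⟩

theorem finite_nonempty_quadratic_roots {α β γ : ℂ} (hβ : β ≠ 0) :
    {t : ℂ | α + t * β + t ^ 2 * γ = 0}.Finite ∧ {t : ℂ | α + t * β + t ^ 2 * γ = 0}.Nonempty := by
  let f : Polynomial ℂ := Polynomial.C γ * Polynomial.X ^ 2 + Polynomial.C β * Polynomial.X +
    Polynomial.C α
  have hev : ∀ t, f.eval t = α + t * β + t ^ 2 * γ := fun t => by
    simp [f]
    ring
  have hcoeff : f.coeff 1 = β := by
    simp [f, Polynomial.coeff_C]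
  have hf0 : f ≠ 0 := fun h => hβ (by rw [← hcoeff, h, Polynomial.coeff_zero])
  have hdeg : f.degree ≠ 0 := fun h => by
    rw [Polynomial.eq_C_of_degree_eq_zero h, Polynomial.coeff_C_succ] at hcoeff
    exact hβ hcoeff.symm
  constructor
  · refine (f.rootSet_finite ℂ).subset fun t ht => ?_
    rw [Polynomial.mem_rootSet]
    exact ⟨hf0, by rw [Polynomial.coe_aeval_eq_eval, hev]; exact ht⟩
  · obtain ⟨t, ht⟩ := IsAlgClosed.exists_root f hdeg
    exact ⟨t, by rw [Set.mem_ofPred_eq, ← hev]; exact ht⟩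

theorem exists_radical_of_generic {m : ℕ} {Q : Fin m → MvPolynomial (Fin n) ℂ}
    (hQ : ∀ i, (Q i).IsHomogeneous 2) {N : Submodule ℂ (Fin n → ℂ)}
    (htype : ∀ i, (∀ w ∈ N, eval w (Q i) = 0) ∨
      ∃ a : (Fin n → ℂ) →ₗ[ℂ] ℂ, ∀ w ∈ N, a w = 0 → polarForm (Q i) w = 0)
    (hcov : ∀ i j, i ≠ j → ∀ y, eval y (Q i) = 0 → eval y (Q j) = 0 →
      ∃ k, k ≠ i ∧ k ≠ j ∧ eval y (Q k) = 0)
    {w₀ : Fin n → ℂ} (hw₀N : w₀ ∈ N)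
    (hw₀ : ∀ i, ¬ N ≤ LinearMap.ker (polarForm (Q i)) → polarForm (Q i) w₀ ≠ 0)
    {x : Fin n → ℂ} (hx : ∀ i, eval x (Q i) ≠ 0)
    (hpol : ∀ i, polarForm (Q i) w₀ ≠ 0 → eval x (polarForm (Q i) w₀) ≠ 0)
    (hdisj : ∀ i j, i ≠ j → polarForm (Q i) w₀ ≠ 0 → ∀ t : ℂ, eval (x + t • w₀) (Q i) = 0 →
      eval (x + t • w₀) (Q j) ≠ 0) :
    ∃ (N₀ : Submodule ℂ (Fin n → ℂ)) (u : Fin 3 → Fin n → ℂ), N₀ ≤ N ∧ (∀ q, u q ∈ N) ∧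
      N ≤ Submodule.span ℂ (Set.range u) ⊔ N₀ ∧
      ∀ i, ∀ w ∈ N₀, eval x (polarForm (Q i) w) = 0 ∧
        ∀ w' ∈ N, eval w' (polarForm (Q i) w) = 0 := by
  let I := {i // polarForm (Q i) w₀ ≠ 0}
  have hex := fun i : I => exists_normalized_functional (hQ i) (htype i) (w₀ := ⟨w₀, hw₀N⟩)
    (hpol i i.2)
  choose p hp1 hpx hpN using hex
  let Z : I → Set ℂ := fun i => {t | eval (x + t • w₀) (Q i) = 0}
  have hev : ∀ (i : I) (w : N), eval (x + (w : Fin n → ℂ)) (Q i) = eval (x + p i w • w₀) (Q i) := by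
    intro i w
    rw [eval_add_smul_of_quadratic (hQ i), eval_add_of_quadratic (hQ i), hpx]
    have h1 := eval_polarForm_self (hQ i) (w : Fin n → ℂ)
    have h2 := eval_polarForm_self (hQ i) w₀
    rw [hpN, h2] at h1
    linear_combination -h1 / 2
  have hZ : ∀ i, (Z i).Finite ∧ (Z i).Nonempty := fun i => by
    simp only [Z, eval_add_smul_of_quadratic (hQ i)]
    exact finite_nonempty_quadratic_roots (hpol i i.2)
  have hrank := finrank_span_le_three_of_cover (w₀ := (⟨w₀, hw₀N⟩ : N)) (p := p) (Z := Z) hp1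
    (fun i => (hZ i).1) (fun i => (hZ i).2)
    (fun i j hij => Set.disjoint_left.mpr fun t hi hj =>
      hdisj i j (fun h => hij (Subtype.ext h)) i.2 t hi hj)
    (by
      intro i j hij w hi hj
      obtain ⟨k, hki, hkj, hk⟩ := hcov i j (fun h => hij (Subtype.ext h)) (x + (w : Fin n → ℂ))
        (by rw [hev]; exact hi) (by rw [hev]; exact hj)
      have hkne : polarForm (Q k) w₀ ≠ 0 := by
        intro h0
        have hle : N ≤ LinearMap.ker (polarForm (Q k)) := by
          by_contra hle
          exact hw₀ k hle h0
        have hpw : polarForm (Q k) w = 0 := hle w.2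
        have hself := eval_polarForm_self (hQ k) (w : Fin n → ℂ)
        rw [hpw, map_zero] at hself
        rw [eval_add_of_quadratic (hQ k), hpw, map_zero] at hk
        exact hx k (by linear_combination hk + hself / 2)
      refine ⟨⟨k, hkne⟩, fun h => hki (congrArg Subtype.val h),
        fun h => hkj (congrArg Subtype.val h), ?_⟩
      change eval (x + p ⟨k, hkne⟩ w • w₀) (Q k) = 0
      rw [← hev ⟨k, hkne⟩]
      exact hk)
  let W : Submodule ℂ (Module.Dual ℂ N) := Submodule.span ℂ (Set.range p)
  obtain ⟨D, hD⟩ := Submodule.exists_isCompl W.dualCoannihilator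
  have hDrank : Module.finrank ℂ D ≤ 3 := by
    have h1 := Subspace.finrank_add_finrank_dualCoannihilator_eq W
    have h2 := Submodule.finrank_add_eq_of_isCompl hD
    have h3 : Module.finrank ℂ W ≤ 3 := hrank
    omega
  obtain ⟨u, huD, hu⟩ := exists_fin_span_ge hDrank
  refine ⟨W.dualCoannihilator.map N.subtype, fun q => u q, ?_, fun q => (u q).2, ?_, ?_⟩
  · exact Submodule.map_subtype_le _ _
  · have htop : ⊤ ≤ Submodule.span ℂ (Set.range u) ⊔ W.dualCoannihilator := by
      rw [← hD.symm.sup_eq_top]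
      exact sup_le_sup_right hu _
    have := Submodule.map_mono (f := N.subtype) htop
    rwa [Submodule.map_sup, Submodule.map_span, ← Set.range_comp, Submodule.map_top,
      Submodule.range_subtype] at this
  · rintro i _ ⟨w, hw, rfl⟩
    by_cases hi : polarForm (Q i) w₀ = 0
    · have hle : N ≤ LinearMap.ker (polarForm (Q i)) := by
        by_contra hle
        exact hw₀ i hle hi
      have hpw : polarForm (Q i) w = 0 := hle w.2
      simp only [Submodule.subtype_apply, hpw, map_zero, implies_true, and_self]
    · have hpw : p ⟨i, hi⟩ w = 0 :=
        (Submodule.mem_dualCoannihilator _).mp hw _ (Submodule.subset_span ⟨_, rfl⟩)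
      refine ⟨?_, fun w' hw' => ?_⟩
      · have := hpx ⟨i, hi⟩ w
        rwa [hpw, zero_mul] at this
      · have := hpN ⟨i, hi⟩ w ⟨w', hw'⟩
        rwa [hpw, zero_mul, zero_mul] at this

end Generic

section Count

variable {n : ℕ}

theorem exists_fin_mem_span_sup_eq_top {N : Submodule ℂ (Fin n → ℂ)}
    {R : MvPolynomial (Fin n) ℂ} (hR : R ≠ 0) :
    ∃ x : Fin (Module.finrank ℂ ((Fin n → ℂ) ⧸ N)) → Fin n → ℂ, (∀ k, eval (x k) R ≠ 0) ∧
      Submodule.span ℂ (Set.range x) ⊔ N = ⊤ := by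
  let G : Set (Fin n → ℂ) := {x | eval x R ≠ 0}
  have hG : Submodule.span ℂ G = ⊤ := by
    by_contra hne
    obtain ⟨f, hf0, hf⟩ := Submodule.exists_le_ker_of_lt_top _ (lt_top_iff_ne_top.mpr hne)
    let L : MvPolynomial (Fin n) ℂ := ∑ j, f (Pi.single j 1) • X j
    have hL : ∀ x, eval x L = f x := fun x => by
      simp only [L, map_sum, smul_eval, eval_X]
      conv_rhs => rw [← LinearMap.sum_single_apply (fun _ : Fin n => ℂ) x, map_sum]
      refine Finset.sum_congr rfl fun j _ => ?_
      have : (Pi.single j (x j) : Fin n → ℂ) = x j • Pi.single j 1 := by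
        rw [← Pi.single_smul, smul_eq_mul, mul_one]
      rw [this, map_smul, smul_eq_mul, mul_comm]
    have hRL : R * L = 0 := MvPolynomial.funext fun x => by
      rw [map_mul, map_zero, hL]
      by_cases hx : eval x R = 0
      · rw [hx, zero_mul]
      · rw [show f x = 0 from hf (Submodule.subset_span hx), mul_zero]
    refine hf0 (LinearMap.ext fun x => ?_)
    rw [← hL, (mul_eq_zero.mp hRL).resolve_left hR, map_zero, LinearMap.zero_apply]
  have hspan : Submodule.span ℂ (N.mkQ '' G) = ⊤ := by
    rw [← Submodule.map_span, hG, Submodule.map_top, Submodule.range_mkQ]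
  obtain ⟨f, hfmem, hfspan, -⟩ := Submodule.exists_fun_fin_finrank_span_eq ℂ (N.mkQ '' G)
  have hcard : Module.finrank ℂ ((Fin n → ℂ) ⧸ N) =
      Module.finrank ℂ (Submodule.span ℂ (N.mkQ '' G)) := by
    rw [hspan, finrank_top]
  choose x hxG hx using hfmem
  refine ⟨fun k => x (Fin.cast hcard k), fun k => hxG _, ?_⟩
  have hrange : (Set.range fun k => x (Fin.cast hcard k)) = Set.range x :=
    (finCongr hcard).surjective.range_comp x
  rw [hrange, eq_top_iff]
  have hmap : (Submodule.span ℂ (Set.range x)).map N.mkQ = ⊤ := by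
    rw [Submodule.map_span, ← Set.range_comp, show N.mkQ ∘ x = f from funext hx, hfspan]
    exact hspan
  rw [sup_comm, ← Submodule.comap_map_mkQ, hmap, Submodule.comap_top]

/-- The linear functional `F ↦ ∑ⱼ wⱼ ∂ⱼF(x)`. -/
noncomputable def polarEval (x w : Fin n → ℂ) : MvPolynomial (Fin n) ℂ →ₗ[ℂ] ℂ where
  toFun F := eval x (polarForm F w)
  map_add' F G := by rw [polarForm_add, LinearMap.add_apply, map_add]
  map_smul' c F := by rw [polarForm_smul, LinearMap.smul_apply, smul_eval]; rfl

theorem finrank_le_of_radical {S : Submodule ℂ (MvPolynomial (Fin n) ℂ)}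
    (hS : ∀ F ∈ S, F.IsHomogeneous 2) {N : Submodule ℂ (Fin n → ℂ)} {d : ℕ}
    {x : Fin d → Fin n → ℂ} (hx : Submodule.span ℂ (Set.range x) ⊔ N = ⊤)
    {M : Fin d → Submodule ℂ (Fin n → ℂ)} {u : Fin d → Fin 3 → Fin n → ℂ}
    (hu : ∀ k, N ≤ Submodule.span ℂ (Set.range (u k)) ⊔ M k)
    (hM : ∀ k, ∀ F ∈ S, ∀ w ∈ M k, eval (x k) (polarForm F w) = 0)
    {M₀ : Submodule ℂ (Fin n → ℂ)} {u₀ : Fin 3 → Fin n → ℂ}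
    (hu₀N : ∀ q, u₀ q ∈ N) (hu₀ : N ≤ Submodule.span ℂ (Set.range u₀) ⊔ M₀)
    (hM₀ : ∀ F ∈ S, ∀ w ∈ M₀, ∀ w' ∈ N, eval w' (polarForm F w) = 0) :
    Module.finrank ℂ S ≤ d * d + (d * 3 + 3 * 3) := by
  let T : S →ₗ[ℂ] ((Fin d × Fin d) ⊕ (Fin d × Fin 3) ⊕ (Fin 3 × Fin 3) → ℂ) :=
    LinearMap.pi (Sum.elim (fun z => polarEval (x z.1) (x z.2))
      (Sum.elim (fun z => polarEval (x z.1) (u z.1 z.2))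
        (fun z => polarEval (u₀ z.1) (u₀ z.2)))) ∘ₗ S.subtype
  have hinj : Function.Injective T := by
    rw [← LinearMap.ker_eq_bot, LinearMap.ker_eq_bot']
    rintro ⟨F, hF⟩ hT
    have hQ := hS F hF
    have h1 : ∀ k l, eval (x k) (polarForm F (x l)) = 0 := fun k l =>
      congrFun hT (Sum.inl (k, l))
    have h2 : ∀ k q, eval (x k) (polarForm F (u k q)) = 0 := fun k q =>
      congrFun hT (Sum.inr (Sum.inl (k, q)))
    have h3 : ∀ q r, eval (u₀ q) (polarForm F (u₀ r)) = 0 := fun q r =>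
      congrFun hT (Sum.inr (Sum.inr (q, r)))
    let φ : (Fin n → ℂ) → (Fin n → ℂ) →ₗ[ℂ] ℂ := fun y => (aeval y).toLinearMap ∘ₗ polarForm F
    have hφ : ∀ y w, φ y w = eval y (polarForm F w) := fun y w => by
      simp [φ, aeval_eq_eval]
    have hφ' : ∀ y w, φ y w = φ w y := fun y w => by
      rw [hφ, hφ, eval_polarForm_comm hQ]
    have hker : ∀ {κ : Type} {z : κ → Fin n → ℂ} {y} {P K : Submodule ℂ (Fin n → ℂ)},
        P ≤ Submodule.span ℂ (Set.range z) ⊔ K → (∀ k, φ y (z k) = 0) → (∀ w ∈ K, φ y w = 0) →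
        ∀ w ∈ P, φ y w = 0 := by
      intro κ z y P K hP hz hK w hw
      have : Submodule.span ℂ (Set.range z) ⊔ K ≤ LinearMap.ker (φ y) := by
        refine sup_le (Submodule.span_le.mpr ?_) hK
        rintro _ ⟨k, rfl⟩
        exact hz k
      exact this (hP hw)
    have h4 : ∀ k, ∀ w ∈ N, φ (x k) w = 0 := fun k =>
      hker (hu k) (fun q => by rw [hφ, h2]) fun w hw => by rw [hφ, hM k F hF w hw]
    have h5 : ∀ q, ∀ w ∈ N, φ (u₀ q) w = 0 := fun q =>
      hker hu₀ (fun r => by rw [hφ, h3]) fun w hw => by rw [hφ, hM₀ F hF w hw _ (hu₀N q)]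
    have h6 : ∀ w' ∈ N, ∀ w ∈ N, φ w' w = 0 := fun w' hw' =>
      hker hu₀ (fun r => by rw [hφ', h5 r w' hw']) fun w hw => by rw [hφ, hM₀ F hF w hw _ hw']
    have h7 : ∀ k, ∀ w, φ (x k) w = 0 := fun k w =>
      hker hx.ge (fun l => by rw [hφ, h1]) (h4 k) w trivial
    have h8 : ∀ w' ∈ N, ∀ w, φ w' w = 0 := fun w' hw' w =>
      hker hx.ge (fun l => by rw [hφ', h7]) (h6 w' hw') w trivial
    have h9 : ∀ y w, φ y w = 0 := fun y w =>
      hker hx.ge (fun l => by rw [hφ', h7]) (fun v hv => by rw [hφ', h8 v hv]) w trivial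
    refine Subtype.ext (MvPolynomial.funext fun y => ?_)
    have hself := eval_polarForm_self hQ y
    rw [← hφ, h9] at hself
    simpa using hself.symm
  have := LinearMap.finrank_le_finrank_of_injective hinj
  simpa using this

theorem finrank_quotient_le {V : Submodule ℂ (MvPolynomial (Fin n) ℂ)} [FiniteDimensional ℂ V]
    (hV : ∀ v ∈ V, v.IsHomogeneous 1) :
    ∃ N : Submodule ℂ (Fin n → ℂ), (∀ w, w ∈ N ↔ ∀ v ∈ V, eval w v = 0) ∧
      Module.finrank ℂ ((Fin n → ℂ) ⧸ N) ≤ Module.finrank ℂ V := by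
  let Φ : (Fin n → ℂ) →ₗ[ℂ] Module.Dual ℂ V :=
    { toFun := fun x => (aeval x).toLinearMap ∘ₗ V.subtype
      map_add' := fun x y => LinearMap.ext fun v => by
        simpa [aeval_eq_eval] using eval_linearForm_add (hV v v.2) x y
      map_smul' := fun c x => LinearMap.ext fun v => by
        simpa [aeval_eq_eval] using eval_linearForm_smul (hV v v.2) c x }
  refine ⟨LinearMap.ker Φ, fun w => ?_, ?_⟩
  · rw [LinearMap.mem_ker, LinearMap.ext_iff]
    simp [Φ, aeval_eq_eval]
  · rw [Φ.quotKerEquivRange.finrank_eq, ← Subspace.dual_finrank_eq (V := V)]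
    exact Submodule.finrank_le _

theorem exists_eval_eq_zero_of_mem_radical {m : ℕ} {Q : Fin m → MvPolynomial (Fin n) ℂ}
    {i j : Fin m}
    (hrad : (∏ k ∈ (Finset.univ.erase i).erase j, Q k) ∈ (Ideal.span {Q i, Q j}).radical)
    {y : Fin n → ℂ} (hi : eval y (Q i) = 0) (hj : eval y (Q j) = 0) :
    ∃ k, k ≠ i ∧ k ≠ j ∧ eval y (Q k) = 0 := by
  obtain ⟨e, he⟩ := hrad
  have hle : Ideal.span {Q i, Q j} ≤ RingHom.ker (eval y) := by
    rw [Ideal.span_le]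
    rintro _ (rfl | rfl)
    exacts [hi, hj]
  have h0 := hle he
  rw [RingHom.mem_ker, map_pow, map_prod] at h0
  obtain ⟨k, hk, hk0⟩ := Finset.prod_eq_zero_iff.mp (eq_zero_of_pow_eq_zero h0)
  simp only [Finset.mem_erase, Finset.mem_univ, and_true] at hk
  exact ⟨k, hk.2, hk.1, hk0⟩

end Count

/-- If a family satisfying the product-Sylvester–Gallai condition is such
that every member either lies in the ideal `⟨V⟩` of a `Δ`-dimensional space `V` of linear
forms, or has minimal space contained in `V + span{a}` for some linear form `a`, then its
span has dimension at most `20·Δ²`. -/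
theorem statement10 {n m Δ : ℕ} (hΔ : 1 ≤ Δ)
    (Q : Fin m → MvPolynomial (Fin n) ℂ)
    (h2 : ∀ i, (Q i).IsHomogeneous 2)
    (hirr : ∀ i, Irreducible (Q i) ∨
      ∃ l : MvPolynomial (Fin n) ℂ, l.IsHomogeneous 1 ∧ Q i = l ^ 2)
    (hpair : ∀ i j, i ≠ j → LinearIndependent ℂ ![Q i, Q j])
    (hrad : ∀ i j, i ≠ j →
      (∏ k ∈ (Finset.univ.erase i).erase j, Q k) ∈ (Ideal.span {Q i, Q j}).radical)
    (V : Submodule ℂ (MvPolynomial (Fin n) ℂ))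
    (hVlin : ∀ v ∈ V, MvPolynomial.IsHomogeneous v 1)
    (hVdim : Module.finrank ℂ V = Δ)
    (hstruct : ∀ i, Q i ∈ Ideal.span (V : Set (MvPolynomial (Fin n) ℂ)) ∨
      ∃ a : MvPolynomial (Fin n) ℂ, a.IsHomogeneous 1 ∧
        MS (Q i) ≤ V ⊔ Submodule.span ℂ {a}) :
    Module.finrank ℂ (Submodule.span ℂ (Set.range Q)) ≤ 20 * Δ ^ 2 := by
  have hΔ2 : 1 ≤ Δ ^ 2 := Nat.one_le_pow _ _ hΔ
  by_cases hm : m ≤ 1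
  · have := finrank_range_le_card (R := ℂ) Q
    rw [Set.finrank, Fintype.card_fin] at this
    omega
  have hQ0 : ∀ i, Q i ≠ 0 := fun i => by
    have : Nontrivial (Fin m) := Fin.nontrivial_iff_two_le.mpr (by omega)
    obtain ⟨j, hj⟩ := exists_ne i
    exact (hpair i j hj.symm).ne_zero 0
  have : FiniteDimensional ℂ V := Module.finite_of_finrank_pos (by omega)
  obtain ⟨N, hN, hNrank⟩ := finrank_quotient_le hVlin
  have htype : ∀ i, (∀ w ∈ N, eval w (Q i) = 0) ∨
      ∃ a : (Fin n → ℂ) →ₗ[ℂ] ℂ, ∀ w ∈ N, a w = 0 → polarForm (Q i) w = 0 := by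
    intro i
    rcases hstruct i with hi | ⟨a, ha, hMS⟩
    · refine Or.inl fun w hw => ?_
      have hle : Ideal.span (V : Set (MvPolynomial (Fin n) ℂ)) ≤ RingHom.ker (eval w) :=
        Ideal.span_le.mpr fun v hv => (hN w).mp hw v hv
      exact hle hi
    · exact Or.inr ⟨linearFormEval ha, fun w hw haw =>
        polarForm_eq_zero_of_MS_le (h2 i) hMS ((hN w).mp hw) haw⟩
  obtain ⟨w₀, hw₀N, hw₀⟩ := exists_mem_forall_apply_ne_zero N fun i => polarForm (Q i)
  have hres : ∀ i j, ∃ R : MvPolynomial (Fin n) ℂ, R ≠ 0 ∧ (i ≠ j → polarForm (Q i) w₀ ≠ 0 →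
      ∀ (x : Fin n → ℂ) (t : ℂ), eval (x + t • w₀) (Q i) = 0 → eval (x + t • w₀) (Q j) = 0 →
        eval x R = 0) := by
    intro i j
    by_cases h : i ≠ j ∧ polarForm (Q i) w₀ ≠ 0
    · obtain ⟨R, hR, hRx⟩ := exists_resultant (h2 i) (h2 j)
        (isRelPrime_of_linearIndependent (h2 i) (h2 j) (hpair i j h.1) (hirr i) (hirr j)) h.2
      exact ⟨R, hR, fun _ _ => hRx⟩
    · exact ⟨1, one_ne_zero, fun h1 h2 => absurd ⟨h1, h2⟩ h⟩
  choose R hR hRx using hres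
  have hpolex : ∀ i, ∃ P : MvPolynomial (Fin n) ℂ, P ≠ 0 ∧
      (polarForm (Q i) w₀ ≠ 0 → P = polarForm (Q i) w₀) := by
    intro i
    by_cases h : polarForm (Q i) w₀ = 0
    · exact ⟨1, one_ne_zero, fun h' => absurd h h'⟩
    · exact ⟨_, h, fun _ => rfl⟩
  choose P hP hPx using hpolex
  let Ψ := (∏ i, Q i) * (∏ i, P i) * ∏ i, ∏ j, R i j
  have hprod : Ψ ≠ 0 := by
    refine mul_ne_zero (mul_ne_zero ?_ ?_) ?_
    · exact Finset.prod_ne_zero_iff.mpr fun i _ => hQ0 i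
    · exact Finset.prod_ne_zero_iff.mpr fun i _ => hP i
    · exact Finset.prod_ne_zero_iff.mpr fun i _ => Finset.prod_ne_zero_iff.mpr fun j _ => hR i j
  have hgen : ∀ x : Fin n → ℂ, eval x Ψ ≠ 0 →
      ∃ (N₀ : Submodule ℂ (Fin n → ℂ)) (u : Fin 3 → Fin n → ℂ), N₀ ≤ N ∧ (∀ q, u q ∈ N) ∧
        N ≤ Submodule.span ℂ (Set.range u) ⊔ N₀ ∧
        ∀ i, ∀ w ∈ N₀, eval x (polarForm (Q i) w) = 0 ∧
          ∀ w' ∈ N, eval w' (polarForm (Q i) w) = 0 := fun x hx => by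
    simp only [Ψ, map_mul, map_prod, mul_ne_zero_iff, Finset.prod_ne_zero_iff, Finset.mem_univ,
      true_implies] at hx
    obtain ⟨⟨hxQ, hxP⟩, hxR⟩ := hx
    exact exists_radical_of_generic h2 htype
      (fun i j hij y => exists_eval_eq_zero_of_mem_radical (hrad i j hij)) hw₀N hw₀ hxQ
      (fun i hi => hPx i hi ▸ hxP i)
      (fun i j hij hi t h1 h2 => hxR i j (hRx i j hij hi x t h1 h2))
  obtain ⟨x₀, hx₀⟩ : ∃ x, eval x Ψ ≠ 0 := by
    by_contra! h
    exact hprod (MvPolynomial.funext fun x => by rw [h, map_zero])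
  obtain ⟨x, hx, hxtop⟩ := exists_fin_mem_span_sup_eq_top (N := N) hprod
  obtain ⟨M₀, u₀, -, hu₀N, hu₀, hM₀⟩ := hgen x₀ hx₀
  choose M u hMN huN hu hM using fun k => hgen (x k) (hx k)
  have hext : ∀ y w : Fin n → ℂ, (∀ i, eval y (polarForm (Q i) w) = 0) →
      ∀ F ∈ Submodule.span ℂ (Set.range Q), eval y (polarForm F w) = 0 := by
    intro y w h
    have : Submodule.span ℂ (Set.range Q) ≤ LinearMap.ker (polarEval y w) := by
      rw [Submodule.span_le]
      rintro _ ⟨i, rfl⟩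
      exact h i
    exact fun F hF => this hF
  have hhom : Submodule.span ℂ (Set.range Q) ≤ homogeneousSubmodule (Fin n) ℂ 2 := by
    rw [Submodule.span_le]
    rintro _ ⟨i, rfl⟩
    exact h2 i
  have hfinal := finrank_le_of_radical (fun F hF => hhom hF) hxtop hu
    (fun k F hF w hw => hext _ _ (fun i => (hM k i w hw).1) F hF) hu₀N hu₀
    (fun F hF w hw w' hw' => hext _ _ (fun i => (hM₀ i w hw).2 w' hw') F hF)
  rw [hVdim] at hNrank
  generalize Module.finrank ℂ ((Fin n → ℂ) ⧸ N) = d at hfinal hNrank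
  nlinarith
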